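/- arXiv:2401.00925 — 2 statements merged into one kernel-verified Lean document; each statement's English description precedes it below -/
import Mathlib

section
/- Let (T,m) be a complete local ring and let Π be the prime subring of T. Suppose that all nonzero elements of Π are regular elements of T and let p be a nonmaximal prime ideal of T such that Π ∩ p = (0). Let y_1, y_2, … be a countable collection of regular elements of T with y_i ∈ m \ p for all i. Then there exists a local domain A ⊆ T such that the (m∩A)-adic completion of A is isomorphic to T, A ∩ p = (0), and for every i there is a unit t_i of T with y_i t_i ∈ A. -/
open IsLocalRing

/-- The `q`-th Frobenius power `I^{[q]}` of an ideal: the ideal generated by `q`-th powers of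
elements of `I`. -/
def Ideal.frobPow {R : Type*} [CommRing R] (I : Ideal R) (q : ℕ) : Ideal R :=
  Ideal.span ((fun r => r ^ q) '' (I : Set R))

/-- Membership in the tight closure `I*` of an ideal `I` in a ring of characteristic `p`:
there is a `c` outside every minimal prime with `c * x^{p^e} ∈ I^{[p^e]}` for all `e ≫ 0`. -/
def Ideal.MemTightClosure {R : Type*} [CommRing R] (p : ℕ) (I : Ideal R) (x : R) : Prop :=
  ∃ c : R, (∀ P ∈ minimalPrimes R, c ∉ P) ∧
    ∃ E : ℕ, ∀ e : ℕ, E ≤ e → c * x ^ p ^ e ∈ I.frobPow (p ^ e)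

/-- A ring of characteristic `p` is weakly F-regular if every ideal is tightly closed. -/
def WeaklyFRegular (R : Type*) [CommRing R] (p : ℕ) : Prop :=
  ∀ (I : Ideal R) (x : R), I.MemTightClosure p x → x ∈ I

/-- A ring is F-regular if all of its localizations are weakly F-regular. -/
def FRegular (R : Type*) [CommRing R] (p : ℕ) : Prop :=
  ∀ S : Submonoid R, WeaklyFRegular (Localization S) p

/-- A ring is catenary if any two saturated chains of primes with the same endpoints have
the same length. -/
def IsCatenaryRing (R : Type*) [CommRing R] : Prop :=
  ∀ (n m : ℕ) (f : Fin (n + 1) → PrimeSpectrum R) (g : Fin (m + 1) → PrimeSpectrum R),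
    f 0 = g 0 → f (Fin.last n) = g (Fin.last m) →
    (∀ i : Fin n, f i.castSucc ⋖ f i.succ) → (∀ i : Fin m, g i.castSucc ⋖ g i.succ) →
    n = m

/-- `y` generates the socle of `T/I`, i.e. `(I : m) = I + (y)` and `y ∉ I`. -/
def IsSocleGenerator {T : Type*} [CommRing T] [IsLocalRing T] (I : Ideal T) (y : T) : Prop :=
  y ∉ I ∧ I.colon (maximalIdeal T) = I ⊔ Ideal.span {y}

/-- An approximately Gorenstein sequence: a descending chain of `m`-primary ideals with
Gorenstein quotients, cofinal with the powers of `m`. -/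
def IsApproxGorensteinSeq (T : Type*) [CommRing T] [IsLocalRing T] (I : ℕ → Ideal T) : Prop :=
  Antitone I ∧ (∀ s, (I s).radical = maximalIdeal T) ∧
  (∀ s, ∃ y, IsSocleGenerator (I s) y) ∧
  ∀ N : ℕ, ∃ S : ℕ, ∀ s : ℕ, S ≤ s → I s ≤ maximalIdeal T ^ N

/-- The set `M_{I,y} = ⋃_{e ≥ 1} ⋂_{f ≥ e} (I^{[p^f]} : y^{p^f})`. -/
def MIy {T : Type*} [CommRing T] (p : ℕ) (I : Ideal T) (y : T) : Set T :=
  {c : T | ∃ e : ℕ, 1 ≤ e ∧ ∀ f : ℕ, e ≤ f → c * y ^ p ^ f ∈ I.frobPow (p ^ f)}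

/-- `depth T ≥ n`: there is a regular sequence of length `n` in the maximal ideal. -/
def DepthGE (T : Type*) [CommRing T] [IsLocalRing T] (n : ℕ) : Prop :=
  ∃ rs : List T, rs.length = n ∧ (∀ x ∈ rs, x ∈ maximalIdeal T) ∧
    RingTheory.Sequence.IsRegular T rs

/-- A Noetherian local ring is Cohen–Macaulay iff there is a regular sequence in the maximal
ideal of length equal to the Krull dimension. -/
def IsCohenMacaulayLocal (T : Type*) [CommRing T] [IsLocalRing T] : Prop :=
  ∃ rs : List T, (∀ x ∈ rs, x ∈ maximalIdeal T) ∧ RingTheory.Sequence.IsRegular T rs ∧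
    (rs.length : WithBot (WithTop ℕ)) = ringKrullDim T

/-- A parameter ideal: generated by `dim T` elements, with radical the maximal ideal. -/
def IsParameterIdeal (T : Type*) [CommRing T] [IsLocalRing T] (I : Ideal T) : Prop :=
  ∃ (n : ℕ) (x : Fin n → T), I = Ideal.span (Set.range x) ∧ I.radical = maximalIdeal T ∧
    (n : WithBot (WithTop ℕ)) = ringKrullDim T

/-- A Noetherian local ring is Gorenstein iff it is Cohen–Macaulay and every parameter ideal
is irreducible (has one-dimensional socle). -/
def IsGorensteinLocal (T : Type*) [CommRing T] [IsLocalRing T] : Prop :=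
  IsCohenMacaulayLocal T ∧ ∀ I : Ideal T, IsParameterIdeal T I → ∃ y, IsSocleGenerator I y

/-- A `p`-subring of a local ring `T`: a quasi-local subring `(R, R ∩ m)` which is small,
misses `p`, and misses every associated prime of `T`. -/
def IsPSubring (T : Type*) [CommRing T] [IsLocalRing T] (P : Ideal T) (R : Subring T) : Prop :=
  IsLocalRing R ∧ (Ideal.comap R.subtype (maximalIdeal T)).IsMaximal ∧
  (Cardinal.mk R ≤ max Cardinal.aleph0 (Cardinal.mk (ResidueField T)) ∧
    (Cardinal.mk R = max Cardinal.aleph0 (Cardinal.mk (ResidueField T)) →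
      Cardinal.mk (ResidueField T) ≤ Cardinal.aleph0)) ∧
  Ideal.comap R.subtype P = ⊥ ∧
  ∀ Q ∈ associatedPrimes T T, Ideal.comap R.subtype Q = ⊥

/-- An N-subring of a local ring `T`: a quasi-local UFD `(R, R ∩ m)` inside `T` which is small,
misses every associated prime of `T`, and such that `R ∩ J` has height at most one for every
`J ∈ Ass(T/tT)`, `t` a nonzerodivisor. -/
def IsNSubring (T : Type*) [CommRing T] [IsLocalRing T] (R : Subring T) : Prop :=
  IsLocalRing R ∧ (Ideal.comap R.subtype (maximalIdeal T)).IsMaximal ∧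
  (∃ _ : IsDomain R, UniqueFactorizationMonoid R) ∧
  (Cardinal.mk R ≤ max Cardinal.aleph0 (Cardinal.mk (ResidueField T)) ∧
    (Cardinal.mk R = max Cardinal.aleph0 (Cardinal.mk (ResidueField T)) →
      Cardinal.mk (ResidueField T) ≤ Cardinal.aleph0)) ∧
  (∀ Q ∈ associatedPrimes T T, Ideal.comap R.subtype Q = ⊥) ∧
  ∀ t ∈ nonZeroDivisors T, ∀ J ∈ associatedPrimes T (T ⧸ Ideal.span {t}),
    ∀ q0 q1 : Ideal R, q0.IsPrime → q1.IsPrime →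
      ¬(q0 < q1 ∧ q1 < Ideal.comap R.subtype J)

section Auxiliary

open Cardinal

theorem smodEq_pow_smul_top_iff {T : Type*} [CommRing T] {I : Ideal T} {n : ℕ} {x y : T} :
    x ≡ y [SMOD (I ^ n • ⊤ : Submodule T T)] ↔ x - y ∈ I ^ n := by
  rw [SModEq.sub_mem, smul_eq_mul, Ideal.mul_top]

theorem exists_powerSeries_value {T : Type*} [CommRing T] {I : Ideal T} [IsAdicComplete I T]
    {w : T} (hw : w ∈ I) (r : ℕ → T) :
    ∃ s : T, ∀ n, s - ∑ i ∈ Finset.range n, r i * w ^ i ∈ I ^ n := by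
  obtain ⟨s, hs⟩ := IsPrecomplete.prec (I := I) (M := T) inferInstance
    (f := fun n => ∑ i ∈ Finset.range n, r i * w ^ i) (by
      intro m n hmn
      rw [smodEq_pow_smul_top_iff, ← neg_sub, ← Finset.sum_Ico_eq_sub _ hmn]
      refine neg_mem (Ideal.sum_mem _ fun i hi => Ideal.mul_mem_left _ _ ?_)
      exact Ideal.pow_le_pow_right (Finset.mem_Ico.mp hi).1 (Ideal.pow_mem_pow hw i))
  refine ⟨s, fun n => ?_⟩
  have := (hs n).symm
  rwa [smodEq_pow_smul_top_iff] at this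

theorem exists_separating_family (T : Type*) [CommRing T] [IsLocalRing T]
    [IsAdicComplete (maximalIdeal T) T] {w : T} (hw : w ∈ maximalIdeal T) :
    ∃ L : (ℕ → ResidueField T) → T, ∀ Q : Ideal T, Q.IsPrime → w ∉ Q →
      ∀ ε δ, L ε - L δ ∈ Q → ε = δ := by
  obtain ⟨rep, hrep⟩ := (residue_surjective (R := T)).hasRightInverse
  choose L hL using fun ε : ℕ → ResidueField T =>
    exists_powerSeries_value hw (fun i => rep (ε i))
  have hres : ∀ ε, residue T (L ε) = ε 0 := by
    intro ε
    have h := hL ε 1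
    rw [pow_one, ← residue_eq_zero_iff] at h
    simpa [sub_eq_zero, hrep _] using h
  have hshift : ∀ ε, L ε = rep (ε 0) + w * L (fun i => ε (i + 1)) := by
    intro ε
    refine (IsHausdorff.eq_iff_smodEq (I := maximalIdeal T)).mpr fun n => ?_
    rw [smodEq_pow_smul_top_iff]
    have h₁ := Ideal.pow_le_pow_right n.le_succ (hL ε (n + 1))
    have h₂ := Ideal.mul_mem_left _ w (hL (fun i => ε (i + 1)) n)
    rw [Finset.sum_range_succ'] at h₁
    convert sub_mem h₁ h₂ using 1
    rw [mul_sub, Finset.mul_sum, Finset.sum_congr rfl fun i _ => show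
      rep (ε (i + 1)) * w ^ (i + 1) = w * (rep (ε (i + 1)) * w ^ i) by ring]
    ring
  refine ⟨L, fun Q hQ hwQ ε δ h => funext fun n => ?_⟩
  have h0 : ∀ ε δ, L ε - L δ ∈ Q → ε 0 = δ 0 := fun ε δ h => by
    have := (residue_eq_zero_iff _).mpr (le_maximalIdeal hQ.ne_top h)
    rwa [map_sub, hres, hres, sub_eq_zero] at this
  induction n generalizing ε δ with
  | zero => exact h0 ε δ h
  | succ n ih =>
    refine ih (fun i => ε (i + 1)) (fun i => δ (i + 1)) ((hQ.mem_or_mem ?_).resolve_left hwQ)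
    have := h
    rw [hshift ε, hshift δ, h0 ε δ h, add_sub_add_left_eq_sub, ← mul_sub] at this
    exact this

theorem mk_quotient_pow_maximalIdeal_le (T : Type*) [CommRing T] [IsLocalRing T]
    [IsNoetherianRing T] (n : ℕ) :
    #(T ⧸ maximalIdeal T ^ n) ≤ max #(ResidueField T) ℵ₀ := by
  obtain ⟨rep, hrep⟩ := (residue_surjective (R := T)).hasRightInverse
  induction n with
  | zero =>
    rw [pow_zero, Ideal.one_eq_top]
    exact (le_one_iff_subsingleton.mpr inferInstance).trans
      (one_le_aleph0.trans (le_max_right _ _))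
  | succ n ih =>
    obtain ⟨s, g, hg⟩ := Submodule.fg_iff_exists_fin_generating_family.mp
      ((isNoetherianRing_iff_ideal_fg T).mp inferInstance (maximalIdeal T ^ n))
    let F : (T ⧸ maximalIdeal T ^ n) × (Fin s → ResidueField T) → T ⧸ maximalIdeal T ^ (n + 1) :=
      fun x => Ideal.Quotient.mk _ (x.1.out + ∑ i, rep (x.2 i) * g i)
    have hF : Function.Surjective F := by
      intro q
      obtain ⟨t, rfl⟩ := Ideal.Quotient.mk_surjective q
      have hmem : t - (Ideal.Quotient.mk (maximalIdeal T ^ n) t).out ∈ maximalIdeal T ^ n := by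
        rw [← Ideal.Quotient.eq]
        exact (Quotient.out_eq _).symm
      obtain ⟨c, hc⟩ := (Submodule.mem_span_range_iff_exists_fun T).mp (hg.ge hmem)
      refine ⟨(Ideal.Quotient.mk _ t, fun i => residue T (c i)), ?_⟩
      refine (Ideal.Quotient.eq.mpr ?_).symm
      rw [← sub_sub]
      change _ - Quotient.out (Ideal.Quotient.mk _ t) - _ ∈ _
      rw [← hc, ← Finset.sum_sub_distrib]
      refine Ideal.sum_mem _ fun i _ => ?_
      rw [smul_eq_mul, ← sub_mul, pow_succ']
      refine Ideal.mul_mem_mul ?_ (hg ▸ Submodule.subset_span ⟨i, rfl⟩)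
      rw [← residue_eq_zero_iff, map_sub, hrep, sub_self]
    refine (mk_le_of_surjective hF).trans ?_
    rw [mk_prod, lift_id, lift_id]
    refine (mul_le_mul' ih ?_).trans (mul_eq_self (le_max_right _ _)).le
    simp only [mk_pi, prod_const, mk_fin, lift_natCast, lift_uzero]
    exact (power_le_power_right (le_max_left _ ℵ₀)).trans (power_nat_le (le_max_right _ _))

theorem mk_le_mk_nat_arrow_residueField (T : Type*) [CommRing T] [IsLocalRing T]
    [IsNoetherianRing T] [IsHausdorff (maximalIdeal T) T] :
    #T ≤ #(ℕ → ResidueField T) := by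
  have hinj : Function.Injective
      (fun (t : T) (n : ℕ) => Ideal.Quotient.mk (maximalIdeal T ^ n) t) := by
    intro a b hab
    refine (IsHausdorff.eq_iff_smodEq (I := maximalIdeal T)).mpr fun n => ?_
    rw [smodEq_pow_smul_top_iff, ← Ideal.Quotient.eq]
    exact congrFun hab n
  have h2 : (2 : Cardinal) ≤ #(ResidueField T) := by
    rw [two_le_iff]; exact ⟨0, 1, zero_ne_one⟩
  refine (mk_le_of_injective hinj).trans ?_
  simp only [mk_pi, prod_const, mk_nat, lift_aleph0, lift_uzero]
  refine (prod_le_prod _ _ (mk_quotient_pow_maximalIdeal_le T)).trans ?_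
  simp only [prod_const, mk_nat, lift_aleph0, lift_uzero]
  have : max #(ResidueField T) ℵ₀ ≤ #(ResidueField T) ^ ℵ₀ :=
    max_le (self_le_power _ one_le_aleph0)
      ((cantor _).le.trans (power_le_power_right h2))
  refine (power_le_power_right this).trans ?_
  rw [← power_mul, aleph0_mul_aleph0]

/-- A subring meeting every ideal of the family `C` only in zero. -/
def Subring.MeetsTrivially {T : Type*} [CommRing T] (R : Subring T) (C : Set (Ideal T)) : Prop :=
  ∀ Q ∈ C, ∀ x ∈ R, x ∈ Q → x = 0

theorem Subring.exists_aeval_of_mem_closure_insert {T : Type*} [CommRing T] {s : Set T} {x z : T}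
    (hz : z ∈ Subring.closure (insert x s)) :
    ∃ f : Polynomial (Subring.closure s), Polynomial.aeval x f = z := by
  have : Subring.closure (insert x s) ≤
      (Polynomial.aeval x : Polynomial (Subring.closure s) →ₐ[_] T).toRingHom.range := by
    rw [Subring.closure_le]
    rintro y (rfl | hy)
    · exact ⟨Polynomial.X, Polynomial.aeval_X y⟩
    · exact ⟨Polynomial.C ⟨y, Subring.subset_closure hy⟩, Polynomial.aeval_C _ _⟩
  exact this hz

theorem Cardinal.mk_iUnion_lt_of_finite.{u} {α ι : Type u} {κ : Cardinal.{u}} (hκ : ℵ₀ < κ)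
    (hι : #ι < κ) {B : ι → Set α} (hB : ∀ i, (B i).Finite) : #(⋃ i, B i) < κ := by
  refine (mk_iUnion_le_sum_mk.trans (sum_le_sum _ (fun _ => ℵ₀) fun i => ?_)).trans_lt ?_
  · exact (hB i).lt_aleph0.le
  · rw [sum_const, lift_id, lift_id]
    exact mul_lt_of_lt hκ.le hι hκ

theorem Subring.mk_closure_lt.{u} {T : Type u} [CommRing T] {κ : Cardinal.{u}} (hκ : ℵ₀ < κ)
    {s : Set T} (hs : #s < κ) : #(Subring.closure s) < κ := by
  have h := Algebra.lift_cardinalMk_adjoin_le ℤ s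
  simp only [mk_int, lift_aleph0, lift_uzero] at h
  have hle : Subring.closure s ≤ (Algebra.adjoin ℤ s).toSubring :=
    Subring.closure_le.mpr Algebra.subset_adjoin
  exact ((mk_le_mk_of_subset hle).trans h).trans_lt (max_lt (max_lt hκ hs) hκ)

/-- If `L` takes more values, distinct modulo every prime of `C`, than a subring has elements, then
some `a + v * L ε` is transcendental over that subring modulo every prime of `C`, and adjoining it
keeps the intersections with these primes trivial. -/
theorem exists_meetsTrivially_closure_insert.{u} {T : Type u} [CommRing T] {E : Type u}
    (hE : ℵ₀ < #E) (C : Set (Ideal T)) (hC : ∀ Q ∈ C, Q.IsPrime) (hCE : #C < #E) (L : E → T)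
    (hL : ∀ Q ∈ C, ∀ ε δ, L ε - L δ ∈ Q → ε = δ) {s : Set T} (hs : #s < #E)
    (hsC : (Subring.closure s).MeetsTrivially C) (a v : T) (hv : ∀ Q ∈ C, v ∉ Q) :
    ∃ ε, (Subring.closure (insert (a + v * L ε) s)).MeetsTrivially C := by
  set R := Subring.closure s
  let B : C × {f : Polynomial R // f ≠ 0} → Set E :=
    fun i => {ε | Polynomial.aeval (a + v * L ε) i.2.1 ∈ i.1.1}
  have hB : ∀ i, (B i).Finite := by
    rintro ⟨⟨Q, hQ⟩, f, hf⟩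
    have := hC Q hQ
    let φ : R →+* T ⧸ Q := (Ideal.Quotient.mk Q).comp R.subtype
    have hφ : Function.Injective φ := by
      rw [injective_iff_map_eq_zero]
      intro r hr
      exact Subtype.ext (hsC Q hQ r r.2 (Ideal.Quotient.eq_zero_iff_mem.mp hr))
    have hf' : f.map φ ≠ 0 := (Polynomial.map_ne_zero_iff hφ).mpr hf
    refine Set.Finite.of_finite_image (f := fun ε => Ideal.Quotient.mk Q (a + v * L ε))
      ((f.map φ).rootSet_finite (T ⧸ Q) |>.subset ?_) ?_
    · rintro _ ⟨ε, hε, rfl⟩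
      rw [Polynomial.mem_rootSet]
      refine ⟨hf', ?_⟩
      have h := Ideal.Quotient.eq_zero_iff_mem.mpr hε
      rw [Polynomial.aeval_def, Polynomial.hom_eval₂] at h
      rw [Polynomial.aeval_def, Polynomial.eval₂_map]
      exact h
    · intro ε _ δ _ h
      have h' := Ideal.Quotient.eq.mp h
      rw [add_sub_add_left_eq_sub, ← mul_sub] at h'
      exact hL Q hQ _ _ ((this.mem_or_mem h').resolve_left (hv Q hQ))
  have hcard : #(⋃ i, B i) < #E := by
    refine mk_iUnion_lt_of_finite hE ?_ hB
    rw [mk_prod, lift_id, lift_id]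
    refine mul_lt_of_lt hE.le hCE ((mk_subtype_le _).trans_lt ?_)
    exact Polynomial.cardinalMk_le_max.trans_lt (max_lt (Subring.mk_closure_lt hE hs) hE)
  obtain ⟨ε, hε⟩ : ∃ ε, ε ∉ ⋃ i, B i := by
    by_contra! h
    rw [Set.eq_univ_of_forall h, mk_univ] at hcard
    exact hcard.false
  refine ⟨ε, fun Q hQ z hz hzQ => ?_⟩
  obtain ⟨f, rfl⟩ := Subring.exists_aeval_of_mem_closure_insert hz
  by_contra hne
  refine hε (Set.mem_iUnion.mpr ⟨⟨⟨Q, hQ⟩, f, ?_⟩, hzQ⟩)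
  rintro rfl
  exact hne (map_zero _)

theorem Subring.MeetsTrivially.mono {T : Type*} [CommRing T] {R S : Subring T}
    {C : Set (Ideal T)} (h : S.MeetsTrivially C) (hRS : R ≤ S) : R.MeetsTrivially C :=
  fun Q hQ x hx => h Q hQ x (hRS hx)

theorem Subring.MeetsTrivially.closure_insert_zero {T : Type*} [CommRing T] {s : Set T}
    {C : Set (Ideal T)} (h : (Subring.closure s).MeetsTrivially C) :
    (Subring.closure (insert 0 s)).MeetsTrivially C :=
  h.mono (Subring.closure_le.mpr (Set.insert_subset (zero_mem _) Subring.subset_closure))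

/-- An element of the subring generated by a nonempty part of a linearly ordered family lies in
the subring generated by the members of the family up to some index of that part. -/
theorem Subring.exists_mem_closure_image_Iic {T I : Type*} [CommRing T] [LinearOrder I]
    (x : I → T) {D : Set I} (hD : D.Nonempty) {z : T} (hz : z ∈ Subring.closure (x '' D)) :
    ∃ β ∈ D, z ∈ Subring.closure (x '' Set.Iic β) := by
  have := hD.to_subtype
  have hdir : Directed (· ≤ ·) fun β : D => Subring.closure (x '' Set.Iic β.1) :=
    Monotone.directed_le fun _ _ h =>
      Subring.closure_mono (Set.image_mono (Set.Iic_subset_Iic.mpr h))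
  have hle : Subring.closure (x '' D) ≤ ⨆ β : D, Subring.closure (x '' Set.Iic β.1) := by
    rw [Subring.closure_le]
    rintro _ ⟨β, hβ, rfl⟩
    exact (Subring.mem_iSup_of_directed hdir).mpr
      ⟨⟨β, hβ⟩, Subring.subset_closure ⟨β, le_rfl, rfl⟩⟩
  obtain ⟨β, hβ⟩ := (Subring.mem_iSup_of_directed hdir).mp (hle hz)
  exact ⟨β.1, β.2, hβ⟩

theorem exists_unbounded_fibers.{u} {I Θ : Type u} [LinearOrder I] [WellFoundedLT I]
    (hI : ord #I = Ordinal.type (α := I) (· < ·)) (hω : ℵ₀ ≤ #I) (hΘ : #Θ ≤ #I) [Nonempty Θ] :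
    ∃ e : I → Θ, ∀ θ β, ∃ α, β < α ∧ e α = θ := by
  have hcard : #(Θ × I) = #I := by
    rw [mk_prod, lift_id, lift_id, mul_eq_right hω hΘ (mk_ne_zero Θ)]
  obtain ⟨e⟩ := Cardinal.eq.mp hcard
  refine ⟨fun i => (e.symm i).1, fun θ β => ?_⟩
  by_contra! h
  have hβ : ∀ i, e (θ, i) ∈ insert β (Set.Iio β) := fun i => by
    by_contra hi
    simp only [Set.mem_insert_iff, Set.mem_Iio, not_or, not_lt] at hi
    exact h _ (lt_of_le_of_ne hi.2 (Ne.symm hi.1)) (by simp)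
  have hinj : Function.Injective fun i => (⟨e (θ, i), hβ i⟩ : ↥(insert β (Set.Iio β))) := by
    intro i j hij
    simpa using hij
  refine ((mk_le_of_injective hinj).trans mk_insert_le).not_gt (add_lt_of_lt hω ?_ ?_)
  · exact mk_Iio_lt β hI
  · exact one_lt_aleph0.trans_le hω

/-- Transfinite construction: if every demand can be met by adjoining a single element to a small
subring, then all demands are met by one subring. -/
theorem exists_subring_meeting_demands.{u} {T : Type u} [CommRing T] (C : Set (Ideal T))
    {κ : Cardinal.{u}} (hκ : ℵ₀ ≤ κ) {Θ : Type u} (hΘ : #Θ ≤ κ)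
    (F : Θ → List T) (G : Θ → Set T) (hbot : (⊥ : Subring T).MeetsTrivially C)
    (step : ∀ s : Set T, #s < κ → (Subring.closure s).MeetsTrivially C →
      ∀ θ, (∀ z ∈ F θ, z ∈ Subring.closure s) →
        ∃ x ∈ G θ, (Subring.closure (insert x s)).MeetsTrivially C) :
    ∃ A : Subring T, A.MeetsTrivially C ∧
      ∀ θ, (∀ z ∈ F θ, z ∈ A) → ∃ x ∈ G θ, x ∈ A := by
  classical
  rcases isEmpty_or_nonempty Θ with hΘe | hΘe
  · exact ⟨⊥, hbot, fun θ => (hΘe.false θ).elim⟩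
  let I := κ.ord.ToType
  have hIκ : #I = κ := mk_ord_toType κ
  have hI : ord #I = Ordinal.type (α := I) (· < ·) := by simp [I]
  obtain ⟨e, he⟩ := exists_unbounded_fibers (Θ := Θ) hI (hIκ ▸ hκ) (hIκ ▸ hΘ)
  have hIne : Nonempty I := by
    rw [← mk_ne_zero_iff, hIκ]
    exact (aleph0_pos.trans_le hκ).ne'
  let next : Set T → Θ → T := fun s θ =>
    if h : ∃ x ∈ G θ, (Subring.closure (insert x s)).MeetsTrivially C then h.choose else 0
  let x : I → T := WellFoundedLT.fix fun α f =>
    next (Set.range fun β : Set.Iio α => f β.1 β.2) (e α)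
  have hx : ∀ α, x α = next (x '' Set.Iio α) (e α) := by
    intro α
    rw [Set.image_eq_range]
    exact WellFoundedLT.fix_eq _ α
  have hIic : ∀ α, x '' Set.Iic α = insert (x α) (x '' Set.Iio α) := fun α => by
    rw [← Set.Iio_insert, Set.image_insert_eq]
  have hnext : ∀ s θ, (Subring.closure s).MeetsTrivially C →
      (Subring.closure (insert (next s θ) s)).MeetsTrivially C := by
    intro s θ hs
    by_cases h : ∃ x ∈ G θ, (Subring.closure (insert x s)).MeetsTrivially C
    · simp only [next, dif_pos h]
      exact h.choose_spec.2
    · simp only [next, dif_neg h]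
      exact hs.closure_insert_zero
  have hD : ∀ D : Set I, (∀ β ∈ D, (Subring.closure (x '' Set.Iic β)).MeetsTrivially C) →
      (Subring.closure (x '' D)).MeetsTrivially C := by
    intro D hD Q hQ z hz hzQ
    rcases D.eq_empty_or_nonempty with rfl | hne
    · rw [Set.image_empty, Subring.closure_empty] at hz
      exact hbot Q hQ z hz hzQ
    · obtain ⟨β, hβ, hzβ⟩ := Subring.exists_mem_closure_image_Iic x hne hz
      exact hD β hβ Q hQ z hzβ hzQ
  have hgood : ∀ α, (Subring.closure (x '' Set.Iic α)).MeetsTrivially C := by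
    intro α
    induction α using WellFoundedLT.induction with
    | _ α ih =>
      rw [hIic, hx]
      exact hnext _ _ (hD _ ih)
  refine ⟨Subring.closure (x '' Set.univ), hD _ fun β _ => hgood β, fun θ hθ => ?_⟩
  obtain ⟨β, hβ⟩ : ∃ β, ∀ z ∈ F θ, z ∈ Subring.closure (x '' Set.Iic β) := by
    generalize F θ = l at hθ
    induction l with
    | nil => exact ⟨hIne.some, by simp⟩
    | cons z l ih =>
      obtain ⟨β, hβ⟩ := ih fun y hy => hθ y (List.mem_cons_of_mem _ hy)
      obtain ⟨γ, -, hγ⟩ := Subring.exists_mem_closure_image_Iic x Set.univ_nonempty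
        (hθ z List.mem_cons_self)
      have mono : ∀ {δ}, δ ≤ max β γ →
          Subring.closure (x '' Set.Iic δ) ≤ Subring.closure (x '' Set.Iic (max β γ)) :=
        fun h => Subring.closure_mono (Set.image_mono (Set.Iic_subset_Iic.mpr h))
      refine ⟨max β γ, fun y hy => ?_⟩
      rcases List.mem_cons.mp hy with rfl | hy
      · exact mono (le_max_right _ _) hγ
      · exact mono (le_max_left _ _) (hβ y hy)
  obtain ⟨α, hα, rfl⟩ := he θ β
  have hex := step (x '' Set.Iio α)
    (mk_image_le.trans_lt ((mk_Iio_lt α hI).trans_eq hIκ)) (hD _ fun β _ => hgood β) (e α)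
    fun z hz => Subring.closure_mono (Set.image_mono (Set.Iic_subset_Iio.mpr hα)) (hβ z hz)
  refine ⟨x α, ?_, Subring.subset_closure ⟨α, trivial, rfl⟩⟩
  rw [hx]
  simp only [next, dif_pos hex]
  exact hex.choose_spec.1

theorem comap_map_eq_of_finitelyGenerated {A T : Type*} [CommRing A] [CommRing T] {f : A →+* T}
    (h : ∀ (l : List A) (c : A), f c ∈ (Ideal.ofList l).map f → c ∈ Ideal.ofList l)
    (J : Ideal A) : (J.map f).comap f = J := by
  classical
  refine le_antisymm (fun c hc => ?_) Ideal.le_comap_map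
  obtain ⟨t, ht, hct⟩ := Submodule.mem_span_finite_of_mem_span (Ideal.mem_comap.mp hc)
  obtain ⟨s, hs, rfl⟩ := Finset.subset_set_image_iff.mp ht
  have hspan : Ideal.ofList s.toList = Ideal.span (s : Set A) :=
    congrArg Ideal.span (Set.ext fun _ => Finset.mem_toList)
  have := h s.toList c (by
    rw [hspan, Ideal.map_span, ← Finset.coe_image]
    exact hct)
  rw [hspan] at this
  exact Ideal.span_le.mpr hs this

theorem isNoetherianRing_of_comap_map_eq {A T : Type*} [CommRing A] [CommRing T]
    [IsNoetherianRing T] {f : A →+* T} (h : ∀ J : Ideal A, (J.map f).comap f = J) :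
    IsNoetherianRing A := by
  have hinj : Function.Injective (Ideal.map f) := Function.LeftInverse.injective h
  have hmono : StrictMono (Ideal.map f) :=
    Monotone.strictMono_of_injective (fun _ _ => Ideal.map_mono) hinj
  exact isNoetherian_iff'.mpr hmono.wellFoundedGT

theorem Subring.isLocalHom_subtype_of_comap_map_eq {T : Type*} [CommRing T] {A : Subring T}
    (h : ∀ J : Ideal A, (J.map A.subtype).comap A.subtype = J) : IsLocalHom A.subtype := by
  refine ⟨fun a ha => ?_⟩
  have h' := h (Ideal.span {a})
  rw [Ideal.map_span, Set.image_singleton, Ideal.span_singleton_eq_top.mpr ha,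
    Ideal.comap_top] at h'
  exact Ideal.span_singleton_eq_top.mp h'.symm

section Completion

variable {T : Type*} [CommRing T] [IsLocalRing T] {A : Subring T}

theorem map_comap_maximalIdeal [IsNoetherianRing T]
    (hsurj : ∀ t : T, ∃ a ∈ A, t - a ∈ maximalIdeal T ^ 2) :
    ((maximalIdeal T).comap A.subtype).map A.subtype = maximalIdeal T := by
  refine le_antisymm Ideal.map_comap_le ?_
  refine Submodule.le_of_le_smul_of_le_jacobson_bot (I := maximalIdeal T)
    (IsNoetherian.noetherian _) (maximalIdeal_le_jacobson _) fun t ht => ?_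
  obtain ⟨a, ha, hta⟩ := hsurj t
  have ham : a ∈ maximalIdeal T := by
    simpa using sub_mem ht (Ideal.pow_le_self two_ne_zero hta)
  refine Submodule.mem_sup.mpr ⟨a, ?_, t - a, ?_, add_sub_cancel _ _⟩
  · exact Ideal.mem_map_of_mem A.subtype
      (show (⟨a, ha⟩ : A) ∈ (maximalIdeal T).comap A.subtype from ham)
  · rwa [smul_eq_mul, ← pow_two]

theorem comap_maximalIdeal_pow
    (h : ∀ J : Ideal A, (J.map A.subtype).comap A.subtype = J)
    (hm : ((maximalIdeal T).comap A.subtype).map A.subtype = maximalIdeal T) (n : ℕ) :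
    (maximalIdeal T ^ n).comap A.subtype = ((maximalIdeal T).comap A.subtype) ^ n := by
  rw [← h (((maximalIdeal T).comap A.subtype) ^ n), Ideal.map_pow, hm]

theorem exists_sub_mem_maximalIdeal_pow
    (hsurj : ∀ t : T, ∃ a ∈ A, t - a ∈ maximalIdeal T)
    (hm : ((maximalIdeal T).comap A.subtype).map A.subtype = maximalIdeal T) (n : ℕ) (t : T) :
    ∃ a ∈ A, t - a ∈ maximalIdeal T ^ n := by
  induction n generalizing t with
  | zero => exact ⟨0, zero_mem _, by simp⟩
  | succ n ih =>
    have key : ∀ z ∈ maximalIdeal T ^ n,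
        ∃ a ∈ A, a ∈ maximalIdeal T ^ n ∧ z - a ∈ maximalIdeal T ^ (n + 1) := by
      intro z hz
      rw [← hm, ← Ideal.map_pow] at hz
      induction hz using Submodule.span_induction with
      | mem z hz =>
        obtain ⟨b, hb, rfl⟩ := hz
        refine ⟨b, b.2, ?_, by simp⟩
        rw [← hm, ← Ideal.map_pow]
        exact Ideal.mem_map_of_mem _ hb
      | zero => exact ⟨0, zero_mem _, zero_mem _, by simp⟩
      | add x y _ _ hx hy =>
        obtain ⟨a, ha, han, hax⟩ := hx
        obtain ⟨b, hb, hbn, hby⟩ := hy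
        refine ⟨a + b, add_mem ha hb, add_mem han hbn, ?_⟩
        rw [add_sub_add_comm]
        exact add_mem hax hby
      | smul u x _ hx =>
        obtain ⟨a, ha, han, hax⟩ := hx
        obtain ⟨b, hb, hub⟩ := hsurj u
        refine ⟨b * a, mul_mem hb ha, Ideal.mul_mem_left _ _ han, ?_⟩
        have h₁ := Ideal.mul_mem_left _ u hax
        have h₂ := Ideal.mul_mem_mul hub han
        rw [← pow_succ'] at h₂
        convert add_mem h₁ h₂ using 1
        rw [smul_eq_mul]
        ring
    obtain ⟨a, ha, hta⟩ := ih t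
    obtain ⟨b, hb, -, hab⟩ := key _ hta
    exact ⟨a + b, add_mem ha hb, by rwa [← sub_sub]⟩

theorem nonempty_adicCompletion_ringEquiv [IsAdicComplete (maximalIdeal T) T]
    (hpow : ∀ n, (maximalIdeal T ^ n).comap A.subtype = ((maximalIdeal T).comap A.subtype) ^ n)
    (hdense : ∀ (n : ℕ) (t : T), ∃ a ∈ A, t - a ∈ maximalIdeal T ^ n) :
    Nonempty (AdicCompletion ((maximalIdeal T).comap A.subtype) A ≃+* T) := by
  set M := (maximalIdeal T).comap A.subtype
  let g : ∀ n, A ⧸ M ^ n →+* T ⧸ maximalIdeal T ^ n :=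
    fun n => Ideal.quotientMap _ A.subtype (hpow n).ge
  have hg : ∀ n, Function.Injective (g n) := fun n => Ideal.quotientMap_injective' (hpow n).le
  let φ := IsAdicComplete.liftRingHom (maximalIdeal T)
    (fun n => (g n).comp (AdicCompletion.evalₐ M n : AdicCompletion M A →+* A ⧸ M ^ n)) (by
      intro m n hmn
      ext x
      obtain ⟨x, rfl⟩ := AdicCompletion.mk_surjective M A x
      have hx := (x.2 hmn).symm
      rw [smodEq_pow_smul_top_iff, ← hpow] at hx
      have hxT : Ideal.Quotient.mk (maximalIdeal T ^ m) (x.1 n : T) =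
          Ideal.Quotient.mk (maximalIdeal T ^ m) (x.1 m : T) := Ideal.Quotient.eq.mpr hx
      simpa [g, Ideal.Quotient.factorPow] using hxT)
  have hφ : ∀ n x, Ideal.Quotient.mk (maximalIdeal T ^ n) (φ x) =
      g n (AdicCompletion.evalₐ M n x) := fun n x => IsAdicComplete.mk_liftRingHom _ _ _ n x
  refine ⟨RingEquiv.ofBijective φ ⟨?_, fun t => ?_⟩⟩
  · rw [injective_iff_map_eq_zero]
    intro x hx
    refine AdicCompletion.ext_evalₐ fun n => hg n ?_
    rw [← hφ, hx, map_zero, map_zero, map_zero]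
  · choose a ha hta using fun n => hdense n t
    have hcauchy : ∀ n, (⟨a n, ha n⟩ : A) ≡ ⟨a (n + 1), ha (n + 1)⟩
        [SMOD (M ^ n • ⊤ : Submodule A A)] := by
      intro n
      rw [smodEq_pow_smul_top_iff, ← hpow]
      have := sub_mem (Ideal.pow_le_pow_right n.le_succ (hta (n + 1))) (hta n)
      simpa using this
    refine ⟨AdicCompletion.mk M A (AdicCompletion.AdicCauchySequence.mk M A _ hcauchy), ?_⟩
    refine (IsHausdorff.eq_iff_smodEq (I := maximalIdeal T)).mpr fun n => ?_
    rw [smodEq_pow_smul_top_iff, ← Ideal.Quotient.eq, hφ, AdicCompletion.evalₐ_mk]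
    exact (Ideal.Quotient.eq.mpr (hta n)).symm

end Completion

theorem mem_nonZeroDivisors_iff_forall_associatedPrimes {T : Type*} [CommRing T]
    [IsNoetherianRing T] {a : T} :
    a ∈ nonZeroDivisors T ↔ ∀ Q ∈ associatedPrimes T T, a ∉ Q := by
  have h := Set.ext_iff.mp (biUnion_associatedPrimes_eq_compl_nonZeroDivisors T) a
  simp only [Set.mem_iUnion, SetLike.mem_coe, Set.mem_compl_iff, exists_prop] at h
  rw [← not_iff_not, ← h]
  push Not
  rfl

theorem Subring.exists_pow_mul_mem_of_mem_closure_insert {T : Type*} [CommRing T] {s : Set T}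
    {a t z : T} (ha : a ∈ Subring.closure s) (hat : a * t ∈ Subring.closure s)
    (hz : z ∈ Subring.closure (insert t s)) : ∃ n : ℕ, a ^ n * z ∈ Subring.closure s := by
  induction hz using Subring.closure_induction with
  | mem x hx =>
    rcases hx with rfl | hx
    · exact ⟨1, by rwa [pow_one]⟩
    · exact ⟨0, by rw [pow_zero, one_mul]; exact Subring.subset_closure hx⟩
  | zero => exact ⟨0, by simp⟩
  | one => exact ⟨0, by simp⟩
  | add x y _ _ hx hy =>
    obtain ⟨m, hm⟩ := hx
    obtain ⟨n, hn⟩ := hy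
    refine ⟨m + n, ?_⟩
    rw [show a ^ (m + n) * (x + y) = a ^ n * (a ^ m * x) + a ^ m * (a ^ n * y) by ring]
    exact add_mem (mul_mem (pow_mem ha _) hm) (mul_mem (pow_mem ha _) hn)
  | neg x _ hx =>
    obtain ⟨n, hn⟩ := hx
    exact ⟨n, by rw [mul_neg]; exact neg_mem hn⟩
  | mul x y _ _ hx hy =>
    obtain ⟨m, hm⟩ := hx
    obtain ⟨n, hn⟩ := hy
    refine ⟨m + n, ?_⟩
    rw [show a ^ (m + n) * (x * y) = (a ^ m * x) * (a ^ n * y) by ring]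
    exact mul_mem hm hn

theorem Subring.MeetsTrivially.closure_insert_of_mul_mem {T : Type*} [CommRing T] {s : Set T}
    {C : Set (Ideal T)} (hs : (Subring.closure s).MeetsTrivially C) {a t : T}
    (ha : a ∈ Subring.closure s) (hreg : a ∈ nonZeroDivisors T)
    (hat : a * t ∈ Subring.closure s) :
    (Subring.closure (insert t s)).MeetsTrivially C := by
  intro Q hQ z hz hzQ
  obtain ⟨n, hn⟩ := Subring.exists_pow_mul_mem_of_mem_closure_insert ha hat hz
  exact (mul_left_mem_nonZeroDivisors_eq_zero_iff (pow_mem hreg n)).mp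
    (hs Q hQ _ hn (Q.mul_mem_left _ hzQ))

/-- One coefficient of a linear combination can be adjoined to a small subring. -/
theorem exists_coefficient_meetsTrivially {T : Type*} [CommRing T] [IsNoetherianRing T]
    {C : Set (Ideal T)} (hass : associatedPrimes T T ⊆ C) {s : Set T}
    (hs : (Subring.closure s).MeetsTrivially C)
    (havoid : ∀ u v : T, (∀ Q ∈ C, v ∉ Q) →
      ∃ z, (Subring.closure (insert (u + v * z) s)).MeetsTrivially C)
    {c a : T} {l : List T} (hc : c ∈ Subring.closure s) (ha : a ∈ Subring.closure s)
    (hl : ∀ b ∈ l, b ∈ Subring.closure s) (hcl : c ∈ Ideal.ofList (a :: l)) :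
    ∃ x, c - a * x ∈ Ideal.ofList l ∧ (Subring.closure (insert x s)).MeetsTrivially C := by
  have hne : ∀ b ∈ Subring.closure s, b ≠ 0 → ∀ Q ∈ C, b ∉ Q :=
    fun b hb hb0 Q hQ hbQ => hb0 (hs Q hQ b hb hbQ)
  rw [Ideal.ofList_cons, Submodule.mem_sup] at hcl
  obtain ⟨y, hy, j, hj, rfl⟩ := hcl
  obtain ⟨t, rfl⟩ := Ideal.mem_span_singleton'.mp hy
  by_cases hb : ∃ b ∈ l, b ≠ 0
  · obtain ⟨b, hbl, hb0⟩ := hb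
    obtain ⟨z, hz⟩ := havoid t b (hne b (hl b hbl) hb0)
    refine ⟨t + b * z, ?_, hz⟩
    rw [show t * a + j - a * (t + b * z) = j - a * z * b by ring]
    exact sub_mem hj (Ideal.mul_mem_left _ _ (Ideal.subset_span hbl))
  · push Not at hb
    have hj0 : j = 0 := by
      have hbot : Ideal.ofList l = ⊥ := Ideal.span_eq_bot.mpr hb
      rwa [hbot] at hj
    subst hj0
    by_cases ha0 : a = 0
    · exact ⟨0, by simp [ha0], hs.closure_insert_zero⟩
    · refine ⟨t, ?_, hs.closure_insert_of_mul_mem ha ?_ ?_⟩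
      · rw [show t * a + 0 - a * t = 0 by ring]
        exact zero_mem _
      · exact mem_nonZeroDivisors_iff_forall_associatedPrimes.mpr
          fun Q hQ => hne a ha ha0 Q (hass hQ)
      · rwa [add_zero, mul_comm] at hc

theorem mem_ofList_of_forall_exists_coefficient {T : Type*} [CommRing T] {A : Subring T}
    (h : ∀ c ∈ A, ∀ a ∈ A, ∀ l : List T, (∀ b ∈ l, b ∈ A) → c ∈ Ideal.ofList (a :: l) →
      ∃ x ∈ A, c - a * x ∈ Ideal.ofList l) (l : List A) (c : A)
    (hc : A.subtype c ∈ (Ideal.ofList l).map A.subtype) : c ∈ Ideal.ofList l := by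
  induction l generalizing c with
  | nil =>
    rw [Ideal.ofList_nil, Ideal.map_bot] at hc
    rw [Ideal.ofList_nil]
    exact Subtype.ext hc
  | cons a l ih =>
    rw [Ideal.map_ofList, List.map_cons] at hc
    obtain ⟨x, hx, hcx⟩ := h c c.2 a a.2 _ (by simp +contextual) hc
    have := ih (c - a * ⟨x, hx⟩) (by rwa [Ideal.map_ofList])
    rw [Ideal.ofList_cons, Submodule.mem_sup]
    exact ⟨a * ⟨x, hx⟩, Ideal.mul_mem_right _ _ (Ideal.mem_span_singleton_self a), _, this,
      add_sub_cancel _ _⟩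

theorem aleph0_lt_mk_nat_arrow {K : Type*} [Nontrivial K] : ℵ₀ < #(ℕ → K) := by
  have h2 : (2 : Cardinal) ≤ #K := by
    rw [two_le_iff]
    exact exists_pair_ne K
  simp only [mk_pi, prod_const, mk_nat, lift_aleph0, lift_uzero]
  exact (cantor _).trans_le (power_le_power_right h2)

/-- A complete local ring has a subring which meets the primes of `C` trivially, contains associates
of prescribed elements, surjects onto the quotient by the square of the maximal ideal, and to which
every finitely generated ideal contracts after extension. -/
theorem exists_subring_dense_closed {T : Type*} [CommRing T] [IsLocalRing T] [IsNoetherianRing T]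
    [IsAdicComplete (maximalIdeal T) T] {C : Set (Ideal T)} (hCfin : C.Finite)
    (hC : ∀ Q ∈ C, Q.IsPrime) (hass : associatedPrimes T T ⊆ C)
    (hbot : (⊥ : Subring T).MeetsTrivially C) (y : ℕ → T)
    (hym : ∀ i, y i ∈ maximalIdeal T) (hyC : ∀ i, ∀ Q ∈ C, y i ∉ Q) :
    ∃ A : Subring T, A.MeetsTrivially C ∧
      (∀ t : T, ∃ a ∈ A, t - a ∈ maximalIdeal T ^ 2) ∧
      (∀ (l : List A) (c : A), A.subtype c ∈ (Ideal.ofList l).map A.subtype →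
        c ∈ Ideal.ofList l) ∧
      ∀ i, ∃ t : Tˣ, y i * (t : T) ∈ A := by
  obtain ⟨L, hL⟩ := exists_separating_family T (hym 0)
  have hE : ℵ₀ < #(ℕ → ResidueField T) := aleph0_lt_mk_nat_arrow
  have hTE := mk_le_mk_nat_arrow_residueField T
  have hΘ : #(T ⊕ ℕ ⊕ T × T × List T) ≤ #(ℕ → ResidueField T) := by
    have hlist : #(List T) ≤ #(ℕ → ResidueField T) :=
      (mk_list_le_max T).trans (max_le hE.le hTE)
    simp only [mk_sum, mk_prod, lift_id, mk_nat, lift_aleph0, lift_uzero]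
    exact add_le_of_le hE.le hTE (add_le_of_le hE.le hE.le
      (mul_le_of_le hE.le hTE (mul_le_of_le hE.le hTE hlist)))
  obtain ⟨A, hAC, hA⟩ := exists_subring_meeting_demands C hE.le hΘ
    (Sum.elim (fun _ => []) (Sum.elim (fun _ => []) fun d => d.1 :: d.2.1 :: d.2.2))
    (Sum.elim (fun t => {x | t - x ∈ maximalIdeal T ^ 2})
      (Sum.elim (fun i => {x | ∃ t : Tˣ, x = y i * t})
        fun d => {x | d.1 ∈ Ideal.ofList (d.2.1 :: d.2.2) →
          d.1 - d.2.1 * x ∈ Ideal.ofList d.2.2}))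
    hbot (by
      intro s hs hsC θ hθ
      have havoid : ∀ u v : T, (∀ Q ∈ C, v ∉ Q) →
          ∃ z, (Subring.closure (insert (u + v * z) s)).MeetsTrivially C := by
        intro u v hv
        obtain ⟨ε, hε⟩ := exists_meetsTrivially_closure_insert hE C hC
          (hCfin.lt_aleph0.trans hE) L (fun Q hQ => hL Q (hC Q hQ) (hyC 0 Q hQ)) hs hsC u v hv
        exact ⟨L ε, hε⟩
      rcases θ with t | i | ⟨c, a, l⟩
      · obtain ⟨z, hz⟩ := havoid t (y 0 ^ 2)
          fun Q hQ h => hyC 0 Q hQ ((hC Q hQ).mem_of_pow_mem 2 h)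
        refine ⟨_, ?_, hz⟩
        change t - (t + y 0 ^ 2 * z) ∈ maximalIdeal T ^ 2
        rw [sub_add_cancel_left]
        exact neg_mem (Ideal.mul_mem_right _ _ (Ideal.pow_mem_pow (hym 0) 2))
      · obtain ⟨z, hz⟩ := havoid (y i) (y i * y 0)
          fun Q hQ h => ((hC Q hQ).mem_or_mem h).elim (hyC i Q hQ) (hyC 0 Q hQ)
        have hunit : IsUnit (1 + y 0 * z) := by
          by_contra hu
          have h1 := sub_mem ((mem_maximalIdeal _).mpr hu)
            (Ideal.mul_mem_right z _ (hym 0))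
          rw [add_sub_cancel_right] at h1
          exact (mem_maximalIdeal _).mp h1 isUnit_one
        refine ⟨_, ⟨hunit.unit, ?_⟩, hz⟩
        rw [IsUnit.unit_spec]
        ring
      · by_cases hcl : c ∈ Ideal.ofList (a :: l)
        · obtain ⟨x, hx, hxC⟩ := exists_coefficient_meetsTrivially hass hsC havoid
            (hθ c (by simp)) (hθ a (by simp)) (fun b hb => hθ b (by simp [hb])) hcl
          exact ⟨x, fun _ => hx, hxC⟩
        · exact ⟨0, fun h => (hcl h).elim, hsC.closure_insert_zero⟩)
  refine ⟨A, hAC, fun t => ?_, mem_ofList_of_forall_exists_coefficient ?_, fun i => ?_⟩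
  · obtain ⟨x, hx, hxA⟩ := hA (Sum.inl t) (by simp)
    exact ⟨x, hxA, hx⟩
  · intro c hc a ha l hl hcl
    obtain ⟨x, hx, hxA⟩ := hA (Sum.inr (Sum.inr (c, a, l))) (by simpa using ⟨hc, ha, hl⟩)
    exact ⟨x, hxA, hx hcl⟩
  · obtain ⟨_, ⟨t, rfl⟩, hxA⟩ := hA (Sum.inr (Sum.inl i)) (by simp)
    exact ⟨t, hxA⟩

end Auxiliary

/-- Local domain precompletions avoiding a prime and containing prescribed
associates. -/
theorem domain_precompletion_with_associates
    (T : Type*) [CommRing T] [IsLocalRing T] [IsNoetherianRing T]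
    [IsAdicComplete (maximalIdeal T) T]
    (hreg : ∀ x ∈ (Int.castRingHom T).range, x ≠ 0 → x ∈ nonZeroDivisors T)
    (P : Ideal T) (hP : P.IsPrime) (hPm : P ≠ maximalIdeal T)
    (hPiP : ∀ x ∈ (Int.castRingHom T).range, x ∈ P → x = 0)
    (y : ℕ → T)
    (hy : ∀ i, y i ∈ nonZeroDivisors T ∧ y i ∈ maximalIdeal T ∧ y i ∉ P) :
    ∃ (A : Subring T) (_ : IsDomain A),
      IsNoetherianRing A ∧ IsLocalRing A ∧
      (Ideal.comap A.subtype (maximalIdeal T)).IsMaximal ∧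
      Nonempty (AdicCompletion (Ideal.comap A.subtype (maximalIdeal T)) A ≃+* T) ∧
      (∀ x : T, x ∈ A → x ∈ P → x = 0) ∧
      ∀ i, ∃ t : Tˣ, y i * (t : T) ∈ A := by
  have hmem : ∀ x ∈ (⊥ : Subring T), x ∈ (Int.castRingHom T).range :=
    fun x hx => (bot_le : ⊥ ≤ (Int.castRingHom T).range) hx
  obtain ⟨A, hAC, hsurj, hclosed, hyA⟩ := exists_subring_dense_closed
    (C := insert P (associatedPrimes T T)) ((associatedPrimes.finite T T).insert P)
    (by
      rintro Q (rfl | hQ)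
      · exact hP
      · exact hQ.isPrime)
    (Set.subset_insert _ _)
    (by
      rintro Q (rfl | hQ) x hx hxQ
      · exact hPiP x (hmem x hx) hxQ
      · by_contra hx0
        exact mem_nonZeroDivisors_iff_forall_associatedPrimes.mp (hreg x (hmem x hx) hx0) Q hQ hxQ)
    y (fun i => (hy i).2.1)
    (by
      rintro i Q (rfl | hQ)
      · exact (hy i).2.2
      · exact mem_nonZeroDivisors_iff_forall_associatedPrimes.mp (hy i).1 Q hQ)
  have hJ := comap_map_eq_of_finitelyGenerated hclosed
  have hm := map_comap_maximalIdeal hsurj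
  have hlocal := Subring.isLocalHom_subtype_of_comap_map_eq hJ
  have hAlocal : IsLocalRing A := RingHom.domain_isLocalRing A.subtype
  have : NoZeroDivisors A := by
    refine ⟨fun {a b} hab => or_iff_not_imp_left.mpr fun ha => Subtype.ext ?_⟩
    have hreg' : (a : T) ∈ nonZeroDivisors T :=
      mem_nonZeroDivisors_iff_forall_associatedPrimes.mpr fun Q hQ haQ =>
        ha (Subtype.ext (hAC Q (Set.mem_insert_of_mem _ hQ) a a.2 haQ))
    exact (mul_left_mem_nonZeroDivisors_eq_zero_iff hreg').mp (congrArg Subtype.val hab)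
  have hdomain : IsDomain A := NoZeroDivisors.to_isDomain A
  refine ⟨A, hdomain, isNoetherianRing_of_comap_map_eq hJ, hAlocal, ?_, ?_,
    hAC P (Set.mem_insert _ _), hyA⟩
  · have hcomap : (maximalIdeal T).comap A.subtype = maximalIdeal A :=
      ((local_hom_TFAE A.subtype).out 0 4).mp hlocal
    rw [hcomap]
    infer_instance
  · refine nonempty_adicCompletion_ringEquiv (comap_maximalIdeal_pow hJ hm)
      (exists_sub_mem_maximalIdeal_pow (fun t => ?_) hm)
    obtain ⟨a, ha, hta⟩ := hsurj t
    exact ⟨a, ha, Ideal.pow_le_self two_ne_zero hta⟩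
end

section
/- Let (T,m) be a complete local equicharacteristic ring with depth T ≥ 2 and let p be a nonmaximal prime ideal of T. Let y be a regular element of T with y ∈ m \ p. Then there exists a local unique factorization domain (A, A∩m) ⊆ T such that the (A∩m)-adic completion of A is isomorphic to T, A ∩ p = (0), and yt ∈ A for some unit t of T. -/
open IsLocalRing

universe u

namespace Precompletion

open Polynomial

variable {T : Type u} [CommRing T]

/-- A prime of grade one: a prime ideal of the form `(z : u)` with `z` a nonzerodivisor. -/
structure IsGradeOnePrime (J : Ideal T) : Prop where
  isPrime : J.IsPrime
  exists_colon : ∃ z ∈ nonZeroDivisors T, ∃ u : T, ∀ j, j ∈ J ↔ z ∣ j * u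

theorem mul_left_cancel_of_nzd {r a b : T} (hr : r ∈ nonZeroDivisors T) (h : r * a = r * b) :
    a = b :=
  (mul_cancel_left_mem_nonZeroDivisors hr).1 h

/-- A grade one prime is of the form `(r : v)` for each nonzerodivisor `r` it contains. -/
theorem IsGradeOnePrime.exists_colon_of_mem {J : Ideal T} (hJ : IsGradeOnePrime J) {r : T}
    (hr : r ∈ nonZeroDivisors T) (hrJ : r ∈ J) : ∃ v : T, ∀ j, j ∈ J ↔ r ∣ j * v := by
  obtain ⟨z, hz, u, hu⟩ := hJ.exists_colon
  obtain ⟨v, hv⟩ := (hu r).1 hrJ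
  refine ⟨v, fun j => (hu j).trans ⟨?_, ?_⟩⟩
  · rintro ⟨w, hw⟩
    refine ⟨w, mul_left_cancel_of_nzd hz ?_⟩
    linear_combination r * hw - j * hv
  · rintro ⟨w, hw⟩
    refine ⟨w, mul_left_cancel_of_nzd hr ?_⟩
    linear_combination z * hw + j * hv

variable [IsNoetherianRing T]

theorem isAssociatedPrime_quotient_span_iff {r : T} {J : Ideal T} :
    IsAssociatedPrime J (T ⧸ Ideal.span {r}) ↔ J.IsPrime ∧ ∃ v : T, ∀ j, j ∈ J ↔ r ∣ j * v := by
  rw [isAssociatedPrime_iff]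
  refine and_congr_right fun _ => ⟨?_, ?_⟩
  · rintro ⟨x, rfl⟩
    obtain ⟨v, rfl⟩ := Ideal.Quotient.mk_surjective x
    refine ⟨v, fun j => ?_⟩
    rw [Submodule.mem_colon_singleton, Submodule.mem_bot, ← Ideal.mem_span_singleton,
      ← Ideal.Quotient.eq_zero_iff_mem]
    rfl
  · rintro ⟨v, hv⟩
    refine ⟨Ideal.Quotient.mk _ v, ?_⟩
    ext j
    rw [hv, Submodule.mem_colon_singleton, Submodule.mem_bot, ← Ideal.mem_span_singleton,
      ← Ideal.Quotient.eq_zero_iff_mem]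
    rfl

theorem finite_isGradeOnePrime_mem {r : T} (hr : r ∈ nonZeroDivisors T) :
    {J : Ideal T | IsGradeOnePrime J ∧ r ∈ J}.Finite := by
  refine (associatedPrimes.finite T (T ⧸ Ideal.span {r})).subset ?_
  rintro J ⟨hJ, hrJ⟩
  exact isAssociatedPrime_quotient_span_iff.2 ⟨hJ.isPrime, hJ.exists_colon_of_mem hr hrJ⟩

/-- An element outside all grade one primes containing `r` is regular modulo `r`. -/
theorem dvd_of_dvd_mul {r b z : T} (hr : r ∈ nonZeroDivisors T)
    (hb : ∀ J : Ideal T, IsGradeOnePrime J → r ∈ J → b ∉ J) (h : r ∣ b * z) : r ∣ z := by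
  by_contra hz
  obtain ⟨J, hJ, hle⟩ := exists_le_isAssociatedPrime_of_isNoetherianRing T
    (Ideal.Quotient.mk (Ideal.span {r}) z)
    (by rwa [Ne, Ideal.Quotient.eq_zero_iff_mem, Ideal.mem_span_singleton])
  have key : ∀ j : T, r ∣ j * z → j ∈ J := fun j hj => hle <| by
    rw [Submodule.mem_colon_singleton, Submodule.mem_bot]
    exact Ideal.Quotient.eq_zero_iff_mem.2 (Ideal.mem_span_singleton.2 hj)
  obtain ⟨hp, v, hv⟩ := isAssociatedPrime_quotient_span_iff.1 hJ
  exact hb J ⟨hp, r, hr, v, hv⟩ (key r (Dvd.intro _ rfl)) (key b h)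

theorem exists_isGradeOnePrime_mem {r : T} (hr : r ∈ nonZeroDivisors T) (hu : ¬ IsUnit r) :
    ∃ J : Ideal T, IsGradeOnePrime J ∧ r ∈ J := by
  by_contra! h
  exact hu (isUnit_of_dvd_one (dvd_of_dvd_mul (b := 0) hr (fun J hJ hrJ => absurd hrJ (h J hJ))
    (by simp)))

theorem mem_nonZeroDivisors_of_forall_notMem {b : T}
    (hb : ∀ Q ∈ associatedPrimes T T, b ∉ Q) : b ∈ nonZeroDivisors T := by
  by_contra h
  have : b ∈ ⋃ p ∈ associatedPrimes T T, (p : Set T) := by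
    rw [biUnion_associatedPrimes_eq_compl_nonZeroDivisors]; exact h
  simp only [Set.mem_iUnion] at this
  obtain ⟨Q, hQ, hbQ⟩ := this
  exact hb Q hQ hbQ

theorem notMem_of_mem_nonZeroDivisors {b : T} (hb : b ∈ nonZeroDivisors T) {Q : Ideal T}
    (hQ : Q ∈ associatedPrimes T T) : b ∉ Q := by
  intro h
  have : b ∈ ⋃ p ∈ associatedPrimes T T, (p : Set T) := by
    simp only [Set.mem_iUnion]; exact ⟨Q, hQ, h⟩
  rw [biUnion_associatedPrimes_eq_compl_nonZeroDivisors] at this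
  exact this hb

end Precompletion

namespace Precompletion

open Polynomial

variable {T : Type u} [CommRing T]

/-- The elements of `T` that are fractions of elements of the subring `B`. -/
def saturation (B : Subring T) : Subring T where
  carrier := {z | ∃ g ∈ B, g ∈ nonZeroDivisors T ∧ g * z ∈ B}
  mul_mem' := by
    rintro a b ⟨g, hg, hg', hga⟩ ⟨h, hh, hh', hhb⟩
    refine ⟨g * h, B.mul_mem hg hh, mul_mem hg' hh', ?_⟩
    convert B.mul_mem hga hhb using 1
    ring
  one_mem' := ⟨1, B.one_mem, one_mem _, by simp [B.one_mem]⟩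
  add_mem' := by
    rintro a b ⟨g, hg, hg', hga⟩ ⟨h, hh, hh', hhb⟩
    refine ⟨g * h, B.mul_mem hg hh, mul_mem hg' hh', ?_⟩
    convert B.add_mem (B.mul_mem hh hga) (B.mul_mem hg hhb) using 1
    ring
  zero_mem' := ⟨1, B.one_mem, one_mem _, by simp [B.zero_mem]⟩
  neg_mem' := by
    rintro a ⟨g, hg, hg', hga⟩
    refine ⟨g, hg, hg', ?_⟩
    convert B.neg_mem hga using 1
    ring

theorem le_saturation (B : Subring T) : B ≤ saturation B :=
  fun z hz => ⟨1, B.one_mem, one_mem _, by simpa using hz⟩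

theorem mem_saturation_of_mul_mem {B : Subring T} {z v : T} (hz : z ∈ saturation B)
    (hz' : z ∈ nonZeroDivisors T) (hzv : z * v ∈ saturation B) : v ∈ saturation B := by
  obtain ⟨g, hg, hg', hgz⟩ := hz
  obtain ⟨h, hh, hh', hhz⟩ := hzv
  refine ⟨g * z * h, B.mul_mem hgz hh, mul_mem (mul_mem hg' hz') hh', ?_⟩
  convert B.mul_mem hg hhz using 1
  ring

theorem saturation_le {B B' : Subring T} (h : B ≤ saturation B') :
    saturation B ≤ saturation B' := by
  rintro z ⟨g, hg, hg', hgz⟩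
  exact mem_saturation_of_mul_mem (h hg) hg' (h hgz)

/-- Evaluation at `x` of polynomials over a subring. -/
noncomputable def evalAt (R : Subring T) (x : T) : R[X] →+* T :=
  eval₂RingHom R.subtype x

@[simp] theorem evalAt_C (R : Subring T) (x : T) (r : R) : evalAt R x (C r) = r := by
  simp [evalAt]

@[simp] theorem evalAt_X (R : Subring T) (x : T) : evalAt R x X = x := by
  simp [evalAt]

/-- The elements of `T` that are fractions of elements of `R[x]`. -/
noncomputable def adjoinSat (R : Subring T) (x : T) : Subring T :=
  saturation (evalAt R x).range

theorem evalAt_mem_adjoinSat (R : Subring T) (x : T) (f : R[X]) :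
    evalAt R x f ∈ adjoinSat R x :=
  le_saturation _ ⟨f, rfl⟩

theorem le_adjoinSat (R : Subring T) (x : T) : R ≤ adjoinSat R x := fun r hr => by
  simpa using evalAt_mem_adjoinSat R x (C ⟨r, hr⟩)

theorem self_mem_adjoinSat (R : Subring T) (x : T) : x ∈ adjoinSat R x := by
  simpa using evalAt_mem_adjoinSat R x X

theorem mem_adjoinSat {R : Subring T} {x z : T} :
    z ∈ adjoinSat R x ↔
      ∃ g f : R[X], evalAt R x g ∈ nonZeroDivisors T ∧ evalAt R x g * z = evalAt R x f := by
  constructor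
  · rintro ⟨_, ⟨g, rfl⟩, hg, ⟨f, hf⟩⟩
    exact ⟨g, f, hg, hf.symm⟩
  · rintro ⟨g, f, hg, hf⟩
    exact ⟨_, ⟨g, rfl⟩, hg, ⟨f, hf.symm⟩⟩

theorem adjoinSat_le {R : Subring T} {x x' : T} (h : x ∈ adjoinSat R x') :
    adjoinSat R x ≤ adjoinSat R x' := by
  refine saturation_le ?_
  rintro _ ⟨f, rfl⟩
  change _ ∈ adjoinSat R x'
  rw [evalAt, coe_eval₂RingHom, eval₂_eq_sum_range]
  exact Subring.sum_mem _ fun i _ =>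
    Subring.mul_mem _ (le_adjoinSat R x' (f.coeff i).2) (Subring.pow_mem _ h _)

/-- `q` generates the contraction of `J` to the subring `R`. -/
structure IsGenerator (R : Subring T) (J : Ideal T) (q : T) : Prop where
  mem : q ∈ R
  mem_ideal : q ∈ J
  exists_eq_mul : ∀ z ∈ R, z ∈ J → ∃ w ∈ R, z = q * w

/-- A subring whose nonzero elements are regular and avoid `P`, which contains all quotients in `T`
of its elements, and in which every grade one prime of `T` contracts to a principal ideal. -/
structure IsTame (P : Ideal T) (R : Subring T) : Prop where
  regular : ∀ r ∈ R, r ≠ 0 → r ∈ nonZeroDivisors T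
  notMem : ∀ r ∈ R, r ≠ 0 → r ∉ P
  mem_of_mul_mem : ∀ z ∈ R, z ≠ 0 → ∀ v, z * v ∈ R → v ∈ R
  exists_generator : ∀ J, IsGradeOnePrime J → ∃ q, IsGenerator R J q

/-- An extension of subrings preserving nonzero generators of contracted grade one primes. -/
structure Extends (R S : Subring T) : Prop where
  le : R ≤ S
  generator : ∀ J, IsGradeOnePrime J → ∀ q, q ≠ 0 → IsGenerator R J q → IsGenerator S J q

theorem Extends.refl (R : Subring T) : Extends R R := ⟨le_rfl, fun _ _ _ _ h => h⟩

theorem Extends.trans {R S U : Subring T} (h : Extends R S) (h' : Extends S U) : Extends R U :=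
  ⟨h.le.trans h'.le, fun J hJ q hq hg => h'.generator J hJ q hq (h.generator J hJ q hq hg)⟩

variable {P : Ideal T} {R : Subring T}

theorem IsTame.generator_of_mem (hR : IsTame P R) {J J' : Ideal T} (hJ : IsGradeOnePrime J)
    (hJ' : IsGradeOnePrime J') {q : T} (hq : q ≠ 0) (hg : IsGenerator R J q) (hqJ' : q ∈ J') :
    IsGenerator R J' q := by
  obtain ⟨q', hq'⟩ := hR.exists_generator J' hJ'
  obtain ⟨u, hu, hqu⟩ := hq'.exists_eq_mul q hg.mem hqJ'
  rcases hJ.isPrime.mem_or_mem (hqu ▸ hg.mem_ideal : q' * u ∈ J) with h | h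
  · obtain ⟨w, hw, e⟩ := hg.exists_eq_mul q' hq'.mem h
    refine ⟨hg.mem, hqJ', fun z hz hzJ => ?_⟩
    obtain ⟨v, hv, rfl⟩ := hq'.exists_eq_mul z hz hzJ
    exact ⟨w * v, R.mul_mem hw hv, by rw [e]; ring⟩
  · obtain ⟨w, hw, e⟩ := hg.exists_eq_mul u hu h
    refine absurd ?_ hJ'.isPrime.one_notMem
    have : q * 1 = q * (q' * w) := by rw [mul_one]; conv_lhs => rw [hqu, e]
                                      ring
    rw [mul_left_cancel_of_nzd (hR.regular q hg.mem hq) this]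
    exact J'.mul_mem_right _ hq'.mem_ideal

/-- `x` is transcendental over `R` modulo `J`. -/
def IsGenericMod (R : Subring T) (x : T) (J : Ideal T) : Prop :=
  ∀ f : R[X], evalAt R x f ∈ J → ∀ n, (f.coeff n : T) ∈ J

theorem IsGenericMod.exists_eq_C_mul {x : T} {J : Ideal T} (hx : IsGenericMod R x J) {q : T}
    (hq : IsGenerator R J q) {f : R[X]} (hf : evalAt R x f ∈ J) :
    ∃ f₁ : R[X], f = C ⟨q, hq.mem⟩ * f₁ := by
  refine (C_dvd_iff_dvd_coeff _ _).2 fun n => ?_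
  obtain ⟨w, hw, e⟩ := hq.exists_eq_mul _ (f.coeff n).2 (hx f hf n)
  exact ⟨⟨w, hw⟩, Subtype.ext e⟩

theorem span_lt_span_of_eq_mul {a b q : T} (hb : b ∈ nonZeroDivisors T) (hq : ¬ IsUnit q)
    (h : a = q * b) : Ideal.span {a} < Ideal.span {b} := by
  refine lt_of_le_of_ne ?_ fun e => hq ?_
  · rw [Ideal.span_singleton_le_span_singleton, h]
    exact Dvd.intro_left _ rfl
  · have : b ∈ Ideal.span {a} := e ▸ Ideal.mem_span_singleton_self b
    obtain ⟨w, hw⟩ := Ideal.mem_span_singleton.1 this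
    refine IsUnit.of_mul_eq_one w (mul_left_cancel_of_nzd hb ?_)
    rw [h] at hw
    linear_combination -hw

theorem IsGradeOnePrime.not_isUnit {J : Ideal T} (hJ : IsGradeOnePrime J) {q : T} (hq : q ∈ J) :
    ¬ IsUnit q := fun h => hJ.isPrime.ne_top (Ideal.eq_top_of_isUnit_mem _ hq h)

theorem IsTame.noZeroDivisors (hR : IsTame P R) : NoZeroDivisors R where
  eq_zero_or_eq_zero_of_mul_eq_zero {a b} hab := by
    by_contra! hne
    exact hne.1 (Subtype.ext ((mul_right_mem_nonZeroDivisors_eq_zero_iff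
      (hR.regular b b.2 (by simpa using hne.2))).1 (congrArg Subtype.val hab)))

/-- Polynomials whose values at `x` lie in `J` are, up to constants, multiples of one of minimal
degree. -/
theorem exists_C_mul_eq_mul [NoZeroDivisors R] {x : T} {J : Ideal T}
    {f₀ : R[X]} (hf₀ : f₀ ≠ 0) (hf₀J : evalAt R x f₀ ∈ J)
    (hmin : ∀ f : R[X], f ≠ 0 → evalAt R x f ∈ J → f₀.natDegree ≤ f.natDegree)
    (h : R[X]) (hh : evalAt R x h ∈ J) :
    ∃ r : R, r ≠ 0 ∧ ∃ u : R[X], C r * h = f₀ * u := by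
  have : Nontrivial R := ⟨⟨f₀.leadingCoeff, 0, leadingCoeff_ne_zero.2 hf₀⟩⟩
  induction hn : h.natDegree using Nat.strong_induction_on generalizing h with
  | _ n ih =>
    subst hn
    by_cases h0 : h = 0
    · exact ⟨1, one_ne_zero, 0, by simp [h0]⟩
    have hle := hmin h h0 hh
    have hl : f₀.leadingCoeff ≠ 0 := leadingCoeff_ne_zero.2 hf₀
    by_cases hd : h.natDegree = 0
    · have hd₀ : f₀.natDegree = 0 := by omega
      refine ⟨f₀.coeff 0, ?_, h, ?_⟩
      · rwa [leadingCoeff, hd₀] at hl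
      · conv_rhs => rw [eq_C_of_natDegree_eq_zero hd₀]
    · have hlt := natDegree_cancelLeads_lt_of_natDegree_le_natDegree hle (by omega)
      have hmem : evalAt R x (f₀.cancelLeads h) ∈ J := by
        simp only [cancelLeads, map_sub, map_mul]
        exact J.sub_mem (J.mul_mem_left _ hh) (J.mul_mem_left _ hf₀J)
      obtain ⟨r, hr, u, hu⟩ := ih _ hlt _ hmem rfl
      refine ⟨r * f₀.leadingCoeff, mul_ne_zero hr hl,
        u + C r * C h.leadingCoeff * X ^ (h.natDegree - f₀.natDegree), ?_⟩
      simp only [cancelLeads, Nat.sub_eq_zero_of_le hle, pow_zero, mul_one] at hu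
      rw [map_mul]
      linear_combination hu

theorem exists_minimal_polynomial {x : T} {J : Ideal T} {f : R[X]} (hf : f ≠ 0)
    (hfJ : evalAt R x f ∈ J) : ∃ f₀ : R[X], f₀ ≠ 0 ∧ evalAt R x f₀ ∈ J ∧
      ∀ f : R[X], f ≠ 0 → evalAt R x f ∈ J → f₀.natDegree ≤ f.natDegree := by
  obtain ⟨f₀, ⟨h0, h1⟩, hmin⟩ := (measure (natDegree (R := R))).wf.has_min
    {f : R[X] | f ≠ 0 ∧ evalAt R x f ∈ J} ⟨f, hf, hfJ⟩
  exact ⟨f₀, h0, h1, fun f hf hfJ => not_lt.1 (hmin f ⟨hf, hfJ⟩)⟩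

/-- If `R` meets `J` and `J'` trivially and both contain the value of a polynomial of minimal degree
for `J`, then all values of polynomials in `J'` lie in `J`. -/
theorem evalAt_mem_of_evalAt_mem [NoZeroDivisors R] {x : T} {J J' : Ideal T} (hJ : J.IsPrime)
    (hRJ : ∀ r ∈ R, r ∈ J → r = 0) (hRJ' : ∀ r ∈ R, r ∈ J' → r = 0)
    {f₀ : R[X]} (hf₀ : f₀ ≠ 0) (hf₀J : evalAt R x f₀ ∈ J)
    (hmin : ∀ f : R[X], f ≠ 0 → evalAt R x f ∈ J → f₀.natDegree ≤ f.natDegree)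
    (hf₀J' : evalAt R x f₀ ∈ J') {h : R[X]} (hh : evalAt R x h ∈ J') : evalAt R x h ∈ J := by
  obtain ⟨f₁, hf₁, hf₁J', hmin₁⟩ := exists_minimal_polynomial hf₀ hf₀J'
  obtain ⟨r, hr, u, hu⟩ := exists_C_mul_eq_mul hf₁ hf₁J' hmin₁ f₀ hf₀J'
  obtain ⟨r', hr', u', hu'⟩ := exists_C_mul_eq_mul hf₁ hf₁J' hmin₁ h hh
  have hne : C r * f₀ ≠ 0 := mul_ne_zero (C_ne_zero.2 hr) hf₀
  have hu0 : u ≠ 0 := by rintro rfl; simp [hu] at hne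
  have hdeg : f₀.natDegree = f₁.natDegree + u.natDegree := by
    rw [← natDegree_C_mul hr, hu, natDegree_mul hf₁ hu0]
  have hf₁J : evalAt R x f₁ ∈ J := by
    have : evalAt R x f₁ * evalAt R x u ∈ J := by
      rw [← map_mul, ← hu, map_mul]
      exact J.mul_mem_left _ hf₀J
    refine (hJ.mem_or_mem this).resolve_right fun huJ => ?_
    have := hmin u hu0 huJ
    have hd : f₁.natDegree = 0 := by omega
    rw [eq_C_of_natDegree_eq_zero hd] at hf₁J' hf₁
    rw [evalAt_C] at hf₁J'
    exact hf₁ (C_eq_zero.2 (Subtype.ext (hRJ' _ (f₁.coeff 0).2 hf₁J')))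
  have : (r' : T) * evalAt R x h ∈ J := by
    rw [← evalAt_C R x r', ← map_mul, hu', map_mul]
    exact J.mul_mem_right _ hf₁J
  exact (hJ.mem_or_mem this).resolve_left fun hm => hr' (Subtype.ext (hRJ _ r'.2 hm))

open Cardinal in
theorem mk_adjoinSat_le (R : Subring T) (x : T) : #(adjoinSat R x) ≤ max ℵ₀ #R := by
  have h : ∀ z : adjoinSat R x, ∃ p : R[X] × R[X], evalAt R x p.1 ∈ nonZeroDivisors T ∧
      evalAt R x p.1 * z = evalAt R x p.2 := fun z => by
    obtain ⟨g, f, h⟩ := mem_adjoinSat.1 z.2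
    exact ⟨(g, f), h⟩
  choose p hp using h
  have hinj : Function.Injective p := fun z z' e => Subtype.ext <| mul_left_cancel_of_nzd
    (hp z).1 (by rw [(hp z).2, e, (hp z').2])
  refine (mk_le_of_injective hinj).trans ?_
  rw [mk_prod, lift_id]
  have : #R[X] ≤ max ℵ₀ #R := by rw [max_comm]; exact Polynomial.cardinalMk_le_max
  exact (mul_le_mul' this this).trans_eq (mul_eq_self (le_max_left _ _))

variable [IsNoetherianRing T]

/-- A generator of a contracted grade one prime remains a generator after adjoining an element
which is transcendental modulo all grade one primes with the same contraction. -/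
theorem IsTame.generator_adjoinSat (hR : IsTame P R) {J : Ideal T} (hJ : IsGradeOnePrime J) {q : T}
    (hq : q ≠ 0) (hg : IsGenerator R J q) {x : T}
    (hx : ∀ J', IsGradeOnePrime J' → IsGenerator R J' q → IsGenericMod R x J') :
    IsGenerator (adjoinSat R x) J q := by
  have hqr := hR.regular q hg.mem hq
  refine ⟨le_adjoinSat R x hg.mem, hg.mem_ideal, fun z hz hzJ => ?_⟩
  obtain ⟨g, f, hgreg, hgf⟩ := mem_adjoinSat.1 hz
  obtain ⟨I, ⟨g, f, rfl, hgreg, hgf⟩, hmax⟩ := set_has_maximal_iff_noetherian.2 ‹_›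
    {I : Ideal T | ∃ g f : R[X], I = Ideal.span {evalAt R x g} ∧
      evalAt R x g ∈ nonZeroDivisors T ∧ evalAt R x g * z = evalAt R x f}
    ⟨_, g, f, rfl, hgreg, hgf⟩
  obtain ⟨f₁, hf₁⟩ := (hx J hJ hg).exists_eq_C_mul hg (f := f) (hgf ▸ J.mul_mem_left _ hzJ)
  have hfq : evalAt R x f = q * evalAt R x f₁ := by rw [hf₁]; simp
  have hgJ : ∀ J', IsGradeOnePrime J' → q ∈ J' → evalAt R x g ∉ J' := by
    intro J' hJ' hqJ' hmem
    have hg' := hR.generator_of_mem hJ hJ' hq hg hqJ'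
    obtain ⟨g₁, hg₁⟩ := (hx J' hJ' hg').exists_eq_C_mul hg' hmem
    have hgq : evalAt R x g = q * evalAt R x g₁ := by rw [hg₁]; simp
    have hreg₁ : evalAt R x g₁ ∈ nonZeroDivisors T := by
      rw [hgq] at hgreg
      exact (mul_mem_nonZeroDivisors.1 hgreg).2
    refine hmax _ ⟨g₁, f₁, rfl, hreg₁, mul_left_cancel_of_nzd hqr ?_⟩
      (span_lt_span_of_eq_mul hreg₁ (hJ.not_isUnit hg.mem_ideal) hgq)
    rw [← hfq, ← hgf, hgq]; ring
  obtain ⟨w, rfl⟩ := dvd_of_dvd_mul hqr hgJ (z := z) ⟨_, hgf.trans hfq⟩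
  refine ⟨w, mem_adjoinSat.2 ⟨g, f₁, hgreg, mul_left_cancel_of_nzd hqr ?_⟩, rfl⟩
  rw [← hfq, ← hgf]; ring


/-- A grade one prime meeting `R` trivially contracts to a principal ideal of `adjoinSat R x`. -/
theorem IsTame.exists_generator_adjoinSat (hR : IsTame P R) {x : T}
    (hx : ∀ f : R[X], f ≠ 0 → evalAt R x f ∈ nonZeroDivisors T)
    (hext : ∀ J, IsGradeOnePrime J → ∀ q, q ≠ 0 → IsGenerator R J q →
      IsGenerator (adjoinSat R x) J q)
    {J : Ideal T} (hJ : IsGradeOnePrime J) (hRJ : ∀ r ∈ R, r ∈ J → r = 0) :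
    ∃ q, IsGenerator (adjoinSat R x) J q := by
  have := hR.noZeroDivisors
  have hJp := hJ.isPrime
  have hRJ' : ∀ r : R, r ≠ 0 → (r : T) ∉ J := fun r hr hm => hr (Subtype.ext (hRJ _ r.2 hm))
  have hRreg : ∀ r : R, r ≠ 0 → (r : T) ∈ nonZeroDivisors T := fun r hr =>
    hR.regular _ r.2 (by simpa using hr)
  by_cases hS : ∃ f : R[X], f ≠ 0 ∧ evalAt R x f ∈ J
  swap
  · push Not at hS
    refine ⟨0, Subring.zero_mem _, J.zero_mem, fun z hz hzJ => ⟨0, Subring.zero_mem _, ?_⟩⟩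
    obtain ⟨g, f, hg, hgf⟩ := mem_adjoinSat.1 hz
    have hf : f = 0 := by
      by_contra hf
      exact hS f hf (hgf ▸ J.mul_mem_left _ hzJ)
    rw [hf, map_zero] at hgf
    rw [mul_zero]
    exact mul_left_cancel_of_nzd hg (by rw [hgf, mul_zero])
  obtain ⟨f, hf, hfJ⟩ := hS
  obtain ⟨f₀, hf₀, hf₀J, hmin⟩ := exists_minimal_polynomial hf hfJ
  have hdeg₀ : f₀.natDegree ≠ 0 := by
    intro hd
    rw [eq_C_of_natDegree_eq_zero hd] at hf₀J hf₀
    rw [evalAt_C] at hf₀J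
    exact hRJ' _ (by simpa using hf₀) hf₀J
  obtain ⟨I, ⟨z₀, rfl, hz₀S, hz₀J, hz₀, r, r', hr, hr', hrr'⟩, hmax⟩ :=
    set_has_maximal_iff_noetherian.2 ‹_›
    {I : Ideal T | ∃ z, I = Ideal.span {z} ∧ z ∈ adjoinSat R x ∧ z ∈ J ∧ z ∈ nonZeroDivisors T ∧
      ∃ r r' : R, r ≠ 0 ∧ r' ≠ 0 ∧ (r' : T) * z = r * evalAt R x f₀}
    ⟨_, _, rfl, evalAt_mem_adjoinSat R x f₀, hf₀J, hx f₀ hf₀, f₀.leadingCoeff, f₀.leadingCoeff,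
      leadingCoeff_ne_zero.2 hf₀, leadingCoeff_ne_zero.2 hf₀, rfl⟩
  have hdisj : ∀ J', IsGradeOnePrime J' → z₀ ∈ J' → ∀ r ∈ R, r ∈ J' → r = 0 := by
    intro J' hJ' hzJ' s hs hsJ'
    obtain ⟨q, hq⟩ := hR.exists_generator J' hJ'
    by_cases hq0 : q = 0
    · obtain ⟨w, -, e⟩ := hq.exists_eq_mul s hs hsJ'
      rw [e, hq0, zero_mul]
    exfalso
    obtain ⟨z₁, hz₁S, e⟩ := (hext J' hJ' q hq0 hq).exists_eq_mul z₀ hz₀S hzJ'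
    have hz₁ : z₁ ∈ nonZeroDivisors T := (mul_mem_nonZeroDivisors.1 (e ▸ hz₀)).2
    have hqR : (⟨q, hq.mem⟩ : R) ≠ 0 := by simpa [Subtype.ext_iff] using hq0
    have hz₁J : z₁ ∈ J := (hJp.mem_or_mem (e ▸ hz₀J)).resolve_left (hRJ' ⟨q, hq.mem⟩ hqR)
    refine hmax _ ⟨z₁, rfl, hz₁S, hz₁J, hz₁, r, r' * ⟨q, hq.mem⟩, hr, mul_ne_zero hr' hqR, ?_⟩
      (span_lt_span_of_eq_mul hz₁ (hJ'.not_isUnit hq.mem_ideal) e)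
    rw [← hrr', e]
    simp [mul_assoc]
  refine ⟨z₀, hz₀S, hz₀J, fun z hz hzJ => ?_⟩
  obtain ⟨g, h, hg, hgh⟩ := mem_adjoinSat.1 hz
  obtain ⟨⟨g, h⟩, ⟨hg, hgh⟩, hgmin⟩ := (measure fun p : R[X] × R[X] => p.1.natDegree).wf.has_min
    {p : R[X] × R[X] | evalAt R x p.1 ∈ nonZeroDivisors T ∧
      evalAt R x p.1 * z = evalAt R x p.2} ⟨(g, h), hg, hgh⟩
  dsimp only at hg hgh
  obtain ⟨s, hs, h₁, hh₁⟩ := exists_C_mul_eq_mul hf₀ hf₀J hmin h (hgh ▸ J.mul_mem_left _ hzJ)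
  have eh := congrArg (evalAt R x) hh₁
  simp only [map_mul, evalAt_C] at eh
  have hgJ : evalAt R x g ∉ J := by
    intro hgJ
    obtain ⟨s', hs', g₁, hg₁⟩ := exists_C_mul_eq_mul hf₀ hf₀J hmin g hgJ
    have eg := congrArg (evalAt R x) hg₁
    simp only [map_mul, evalAt_C] at eg
    have hT : Nontrivial T := ⟨⟨1, 0, fun e => hJp.one_notMem (e ▸ J.zero_mem)⟩⟩
    have hg0 : g ≠ 0 := by
      rintro rfl
      rw [map_zero] at hg
      exact zero_notMem_nonZeroDivisors hg
    have hg₁0 : g₁ ≠ 0 := by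
      rintro rfl
      exact mul_ne_zero (C_ne_zero.2 hs') hg0 (by rw [hg₁, mul_zero])
    refine hgmin (C s * g₁, C s' * h₁) ⟨hx _ (mul_ne_zero (C_ne_zero.2 hs) hg₁0), ?_⟩ ?_
    · refine mul_left_cancel_of_nzd (hx f₀ hf₀) ?_
      simp only [map_mul, evalAt_C]
      linear_combination s * s' * hgh - s * z * eg + s' * eh
    · change (C s * g₁).natDegree < g.natDegree
      have : (C s' * g).natDegree = (f₀ * g₁).natDegree := by rw [hg₁]
      rw [natDegree_C_mul hs', natDegree_mul hf₀ hg₁0] at this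
      rw [natDegree_C_mul hs]
      omega
  have key : (r : T) * s * evalAt R x g * z = z₀ * (r' * evalAt R x h₁) := by
    linear_combination r * s * hgh + r * eh - evalAt R x h₁ * hrr'
  obtain ⟨w, rfl⟩ : z₀ ∣ z := by
    refine dvd_of_dvd_mul hz₀ (fun J' hJ' hzJ' hm => ?_) ⟨_, key⟩
    have hd := hdisj J' hJ' hzJ'
    have hp' := hJ'.isPrime
    have hd' : ∀ r : R, r ≠ 0 → (r : T) ∉ J' := fun r hr hm => hr (Subtype.ext (hd _ r.2 hm))
    have hf₀J' : evalAt R x f₀ ∈ J' :=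
      (hp'.mem_or_mem (hrr' ▸ J'.mul_mem_left _ hzJ' : (r : T) * _ ∈ J')).resolve_left (hd' r hr)
    refine hgJ (evalAt_mem_of_evalAt_mem hJp hRJ hd hf₀ hf₀J hmin hf₀J' ?_)
    refine (hp'.mem_or_mem hm).resolve_left fun hm => ?_
    exact (hp'.mem_or_mem hm).elim (hd' r hr) (hd' s hs)
  refine ⟨w, mem_adjoinSat.2 ⟨C r * C s * g, C r' * h₁, ?_, mul_left_cancel_of_nzd hz₀ ?_⟩, rfl⟩
  · simp only [map_mul, evalAt_C]
    exact mul_mem (mul_mem (hRreg r hr) (hRreg s hs)) hg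
  · simp only [map_mul, evalAt_C]
    linear_combination key

/-- Adjoining a sufficiently transcendental element to a tame subring yields a tame extension. -/
theorem IsTame.isTame_and_extends_adjoinSat (hR : IsTame P R) {x : T}
    (hreg : ∀ f : R[X], f ≠ 0 → evalAt R x f ∈ nonZeroDivisors T)
    (hxP : ∀ f : R[X], f ≠ 0 → evalAt R x f ∉ P)
    (hx : ∀ J, IsGradeOnePrime J → ∀ q, q ≠ 0 → IsGenerator R J q →
      ∃ x', adjoinSat R x' = adjoinSat R x ∧
        ∀ J', IsGradeOnePrime J' → IsGenerator R J' q → IsGenericMod R x' J') :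
    IsTame P (adjoinSat R x) ∧ Extends R (adjoinSat R x) := by
  have hext : ∀ J, IsGradeOnePrime J → ∀ q, q ≠ 0 → IsGenerator R J q →
      IsGenerator (adjoinSat R x) J q := by
    intro J hJ q hq hg
    obtain ⟨x', e, hx'⟩ := hx J hJ q hq hg
    exact e ▸ hR.generator_adjoinSat hJ hq hg hx'
  have hS : ∀ z ∈ adjoinSat R x, z ≠ 0 → ∃ g f : R[X], f ≠ 0 ∧
      evalAt R x g * z = evalAt R x f := by
    intro z hz hz0
    obtain ⟨g, f, hg, hgf⟩ := mem_adjoinSat.1 hz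
    refine ⟨g, f, ?_, hgf⟩
    rintro rfl
    exact hz0 (mul_left_cancel_of_nzd hg (by rw [hgf, map_zero, mul_zero]))
  have hSreg : ∀ z ∈ adjoinSat R x, z ≠ 0 → z ∈ nonZeroDivisors T := by
    intro z hz hz0
    obtain ⟨g, f, hf, hgf⟩ := hS z hz hz0
    exact (mul_mem_nonZeroDivisors.1 (hgf ▸ hreg f hf : evalAt R x g * z ∈ _)).2
  refine ⟨⟨hSreg, fun z hz hz0 hzP => ?_, fun z hz hz0 v hv => ?_, fun J hJ => ?_⟩,
    le_adjoinSat R x, hext⟩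
  · obtain ⟨g, f, hf, hgf⟩ := hS z hz hz0
    exact hxP f hf (hgf ▸ P.mul_mem_left _ hzP)
  · exact mem_saturation_of_mul_mem hz (hSreg z hz hz0) hv
  · obtain ⟨q, hq⟩ := hR.exists_generator J hJ
    by_cases hq0 : q = 0
    · refine hR.exists_generator_adjoinSat hreg hext hJ fun r hr hrJ => ?_
      obtain ⟨w, -, e⟩ := hq.exists_eq_mul r hr hrJ
      rw [e, hq0, zero_mul]
    · exact ⟨q, hext J hJ q hq0 hq⟩

end Precompletion

namespace Precompletion

open Polynomial Cardinal

variable {T : Type u} [CommRing T]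

theorem map_comp_ne_zero {J : Ideal T} (hJ : J.IsPrime) {F W : T[X]}
    (hF : F.map (Ideal.Quotient.mk J) ≠ 0) {n : ℕ} (hW : W.coeff (n + 1) ∉ J) :
    (F.comp W).map (Ideal.Quotient.mk J) ≠ 0 := by
  rw [map_comp, Ne, comp_eq_zero_iff]
  rintro (h | ⟨-, h⟩)
  · exact hF h
  · have := congrArg (fun p => p.coeff (n + 1)) h
    simp only [coeff_map, coeff_C_succ] at this
    exact hW (Ideal.Quotient.eq_zero_iff_mem.1 this)

theorem eval_mem_iff {J : Ideal T} {F : T[X]} {w : T} :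
    F.eval w ∈ J ↔ (F.map (Ideal.Quotient.mk J)).eval (Ideal.Quotient.mk J w) = 0 := by
  rw [eval_map, eval₂_hom, Ideal.Quotient.eq_zero_iff_mem]

theorem finite_setOf_eval_mem {κ : Type*} {J : Ideal T} (hJ : J.IsPrime) {F : T[X]}
    (hF : F.map (Ideal.Quotient.mk J) ≠ 0) {l : κ → T}
    (hl : Function.Injective fun c => Ideal.Quotient.mk J (l c)) :
    {c | F.eval (l c) ∈ J}.Finite := by
  refine Set.Finite.of_finite_image (f := fun c => Ideal.Quotient.mk J (l c)) ?_ hl.injOn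
  refine (finite_setOfPred_isRoot hF).subset ?_
  rintro _ ⟨c, hc, rfl⟩
  exact eval_mem_iff.1 hc

variable [IsLocalRing T]

theorem injective_mk_pow_succ {J : Ideal T} (hJ : J.IsPrime) {e w : T} (he : e ∉ J)
    (hem : e ∈ maximalIdeal T) :
    Function.Injective fun n : ℕ => Ideal.Quotient.mk J (w + e ^ (n + 1)) := by
  have key : ∀ a b : ℕ, a < b → Ideal.Quotient.mk J (w + e ^ (a + 1)) ≠
      Ideal.Quotient.mk J (w + e ^ (b + 1)) := by
    intro a b hab h
    have h' := Ideal.Quotient.eq.1 h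
    obtain ⟨d, rfl⟩ := Nat.exists_eq_add_of_lt hab
    have hmem : e ^ (a + 1) * (1 - e ^ (d + 1)) ∈ J := by
      convert h' using 1
      ring
    rcases hJ.mem_or_mem hmem with h1 | h1
    · exact he (hJ.mem_of_pow_mem _ h1)
    · refine hJ.ne_top (Ideal.eq_top_of_isUnit_mem _ h1 ?_)
      by_contra hu
      have h2 : 1 - e ^ (d + 1) ∈ maximalIdeal T := hu
      have h3 : e ^ (d + 1) ∈ maximalIdeal T := Ideal.pow_mem_of_mem _ hem _ (Nat.succ_pos _)
      exact (maximalIdeal.isMaximal T).isPrime.one_notMem (by simpa using add_mem h2 h3)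
  intro a b h
  rcases lt_trichotomy a b with h1 | h1 | h1
  · exact absurd h (key a b h1)
  · exact h1
  · exact absurd h.symm (key b a h1)

/-- Cardinals that are countable or smaller than the residue field. -/
def IsSmall (T : Type u) [CommRing T] [IsLocalRing T] (c : Cardinal.{u}) : Prop :=
  c ≤ ℵ₀ ∨ c < #(ResidueField T)

theorem IsSmall.of_le_max {c d : Cardinal.{u}} (hd : IsSmall T d) (h : c ≤ max ℵ₀ d) :
    IsSmall T c := by
  rcases le_max_iff.1 h with h | h
  · exact Or.inl h
  · exact hd.imp h.trans h.trans_lt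

variable [IsNoetherianRing T]

/-- Fewer than `#(ResidueField T)` polynomial conditions modulo primes can be avoided in an ideal
that is contained in none of these primes. -/
theorem exists_mem_forall_eval_notMem_of_lt {ι : Type u} (J : ι → Ideal T) (F : ι → T[X])
    (hJ : ∀ i, (J i).IsPrime) (hF : ∀ i, (F i).map (Ideal.Quotient.mk (J i)) ≠ 0) (I : Ideal T)
    (hI : ∀ i, ¬ I ≤ J i) (hcard : max ℵ₀ #ι < #(ResidueField T)) :
    ∃ w ∈ I, ∀ i, (F i).eval w ∉ J i := by
  obtain ⟨n, e, he⟩ := Submodule.fg_iff_exists_fin_generating_family.1 (IsNoetherian.noetherian I)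
  let W : T[X] := ∑ j : Fin n, C (e j) * X ^ ((j : ℕ) + 1)
  have hW : ∀ j : Fin n, W.coeff ((j : ℕ) + 1) = e j := by
    intro j
    simp only [W, finsetSum_coeff, coeff_C_mul_X_pow]
    rw [Finset.sum_eq_single j]
    · simp
    · intro b _ hb
      rw [if_neg]
      intro h
      exact hb (Fin.ext (by omega))
    · simp
  have hG : ∀ i, ((F i).comp W).map (Ideal.Quotient.mk (J i)) ≠ 0 := by
    intro i
    obtain ⟨j, hj⟩ : ∃ j, e j ∉ J i := by
      by_contra! h
      exact hI i (he ▸ Submodule.span_le.2 (by rintro _ ⟨j, rfl⟩; exact h j))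
    exact map_comp_ne_zero (hJ i) (hF i) (n := j) (by rwa [hW])
  let l : ResidueField T → T := Function.surjInv residue_surjective
  have hl : ∀ c, residue T (l c) = c := Function.surjInv_eq residue_surjective
  have hfin : ∀ i, {c | ((F i).comp W).eval (l c) ∈ J i}.Finite := by
    intro i
    refine finite_setOf_eval_mem (hJ i) (hG i) fun c c' h => ?_
    have h' := Ideal.Quotient.eq.1 h
    rw [← hl c, ← hl c']
    exact Ideal.Quotient.eq.2 (le_maximalIdeal (hJ i).ne_top h')
  obtain ⟨c, hc⟩ : ∃ c, c ∉ ⋃ i, {c | ((F i).comp W).eval (l c) ∈ J i} := by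
    by_contra! h
    refine hcard.not_ge ?_
    rw [← mk_univ, ← Set.eq_univ_of_forall h]
    refine (mk_iUnion_le _).trans ?_
    rw [max_comm]
    refine (mul_le_max _ _).trans ?_
    refine max_le (max_le (le_max_left _ _) ?_) (le_max_right _ _)
    exact (ciSup_le' fun i => (lt_aleph0_iff_set_finite.2 (hfin i)).le).trans (le_max_right _ _)
  refine ⟨W.eval (l c), ?_, fun i hi => hc (Set.mem_iUnion.2 ⟨i, ?_⟩)⟩
  · rw [eval_finsetSum]
    refine I.sum_mem fun j _ => ?_
    rw [eval_mul, eval_C]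
    exact I.mul_mem_right _ (he ▸ Submodule.subset_span ⟨j, rfl⟩)
  · rwa [Set.mem_ofPred_eq, eval_comp]

/-- Ideals of a Noetherian local ring are closed. -/
theorem exists_forall_notMem_of_notMem {I : Ideal T} {x : T} (hx : x ∉ I) :
    ∃ k, ∀ v, v - x ∈ maximalIdeal T ^ k → v ∉ I := by
  have h := Ideal.iInf_pow_smul_eq_bot_of_isLocalRing (M := T ⧸ I) (maximalIdeal T)
    (maximalIdeal.isMaximal T).ne_top
  have hx' : Ideal.Quotient.mk I x ∉ (⊥ : Submodule T (T ⧸ I)) := by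
    rwa [Submodule.mem_bot, Ideal.Quotient.eq_zero_iff_mem]
  rw [← h, Submodule.mem_iInf] at hx'
  push Not at hx'
  obtain ⟨k, hk⟩ := hx'
  refine ⟨k, fun v hv hvI => hk ?_⟩
  have e : Ideal.Quotient.mk I x = (-(v - x)) • (1 : T ⧸ I) := by
    rw [Algebra.smul_def, mul_one, Ideal.Quotient.algebraMap_eq, Ideal.Quotient.eq]
    convert hvI using 1
    ring
  rw [e]
  exact Submodule.smul_mem_smul (neg_mem hv) trivial

theorem exists_approximation {J I : Ideal T} (hJ : J.IsPrime) (hJm : J ≠ maximalIdeal T)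
    (hI : ¬ I ≤ J) {F : T[X]} (hF : F.map (Ideal.Quotient.mk J) ≠ 0) (w : T) (hw : w ∈ I) (k : ℕ) :
    ∃ w' ∈ I, w' - w ∈ maximalIdeal T ^ k ∧ ∃ k', k < k' ∧
      ∀ v, v - w' ∈ maximalIdeal T ^ k' → F.eval v ∉ J := by
  obtain ⟨a, ha, haJ⟩ : ∃ a ∈ maximalIdeal T, a ∉ J := SetLike.not_le_iff_exists.1 fun h =>
    hJm (le_antisymm (le_maximalIdeal hJ.ne_top) h)
  obtain ⟨b, hb, hbJ⟩ := SetLike.not_le_iff_exists.1 hI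
  have heJ : a ^ (k + 1) * b ∉ J := fun h =>
    (hJ.mem_or_mem h).elim (fun h => haJ (hJ.mem_of_pow_mem _ h)) hbJ
  have heI : a ^ (k + 1) * b ∈ I := I.mul_mem_left _ hb
  have hek : a ^ (k + 1) * b ∈ maximalIdeal T ^ (k + 1) :=
    Ideal.mul_mem_right _ _ (Ideal.pow_mem_pow ha _)
  have hem : a ^ (k + 1) * b ∈ maximalIdeal T := Ideal.pow_le_self (Nat.succ_ne_zero k) hek
  generalize a ^ (k + 1) * b = e at heJ heI hek hem
  have hfin := finite_setOf_eval_mem hJ hF (injective_mk_pow_succ (w := w) hJ heJ hem)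
  obtain ⟨n, hn'⟩ : ∃ n : ℕ, F.eval (w + e ^ (n + 1)) ∉ J := by
    by_contra! hall
    exact Set.infinite_univ (hfin.subset fun n _ => hall n)
  obtain ⟨k', hk'⟩ := exists_forall_notMem_of_notMem hn'
  refine ⟨w + e ^ (n + 1), add_mem hw (Ideal.pow_mem_of_mem _ heI _ (Nat.succ_pos _)), ?_,
    max k' (k + 1), lt_of_lt_of_le (Nat.lt_succ_self k) (le_max_right _ _), fun v hv => hk' _ ?_⟩
  · rw [add_sub_cancel_left]
    exact Ideal.pow_mem_of_mem _ (Ideal.pow_le_pow_right (Nat.le_succ k) hek) _ (Nat.succ_pos _)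
  · exact Ideal.mem_of_dvd _ (sub_dvd_eval_sub _ _ F)
      (Ideal.pow_le_pow_right (le_max_left _ _) hv)

/-- In a complete local ring, countably many polynomial conditions modulo nonmaximal primes can be
avoided in an ideal that is contained in none of these primes. -/
theorem exists_mem_forall_eval_notMem_of_countable [IsAdicComplete (maximalIdeal T) T]
    {ι : Type*} [Countable ι] (J : ι → Ideal T) (F : ι → T[X])
    (hJ : ∀ i, (J i).IsPrime) (hJm : ∀ i, J i ≠ maximalIdeal T)
    (hF : ∀ i, (F i).map (Ideal.Quotient.mk (J i)) ≠ 0) (I : Ideal T)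
    (hI : ∀ i, ¬ I ≤ J i) : ∃ w ∈ I, ∀ i, (F i).eval w ∉ J i := by
  cases isEmpty_or_nonempty ι with
  | inl h => exact ⟨0, I.zero_mem, fun i => h.elim i⟩
  | inr h =>
  obtain ⟨σ, hσ⟩ := exists_surjective_nat ι
  have step : ∀ (n : ℕ) (p : I × ℕ), ∃ p' : I × ℕ, (p'.1 - p.1 : T) ∈ maximalIdeal T ^ p.2 ∧
      p.2 < p'.2 ∧ ∀ v : T, v - p'.1 ∈ maximalIdeal T ^ p'.2 → (F (σ n)).eval v ∉ J (σ n) := by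
    rintro n ⟨⟨w, hw⟩, k⟩
    obtain ⟨w', hw', h1, k', hk, h2⟩ :=
      exists_approximation (hJ (σ n)) (hJm _) (hI _) (hF _) w hw k
    exact ⟨(⟨w', hw'⟩, k'), h1, hk, h2⟩
  choose φ hφ1 hφ2 hφ3 using step
  let s : ℕ → I × ℕ := fun n => Nat.rec (0, 0) φ n
  have hs : ∀ n, s (n + 1) = φ n (s n) := fun n => rfl
  have hmono : StrictMono fun n => (s n).2 := strictMono_nat_of_lt_succ fun n => by
    rw [hs]; exact hφ2 _ _
  have hcauchy : ∀ m n, m ≤ n → ((s n).1 - (s m).1 : T) ∈ maximalIdeal T ^ (s m).2 := by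
    intro m n hmn
    induction n, hmn using Nat.le_induction with
    | base => simp
    | succ n hmn ih =>
      have h1 := Ideal.pow_le_pow_right (hmono.monotone hmn) (hφ1 n (s n))
      rw [← hs] at h1
      convert add_mem h1 ih using 1
      ring
  obtain ⟨L, hL⟩ := IsPrecomplete.prec' (I := maximalIdeal T) (fun n => ((s n).1 : T)) (by
    intro m n hmn
    rw [SModEq.sub_mem, smul_eq_mul, Ideal.mul_top, ← neg_mem_iff, neg_sub]
    exact Ideal.pow_le_pow_right hmono.le_apply (hcauchy m n hmn))
  simp only [SModEq.sub_mem, smul_eq_mul, Ideal.mul_top] at hL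
  have hL' : ∀ n, (L - (s n).1 : T) ∈ maximalIdeal T ^ (s n).2 := by
    intro n
    set N := max n (s n).2
    have h1 := Ideal.pow_le_pow_right (le_max_right n (s n).2) (hL N)
    convert sub_mem (hcauchy n N (le_max_left _ _)) h1 using 1
    ring
  refine ⟨L, ?_, fun i => ?_⟩
  · by_contra hLI
    obtain ⟨k, hk⟩ := exists_forall_notMem_of_notMem hLI
    exact hk _ (hL k) (s k).1.2
  · obtain ⟨n, rfl⟩ := hσ i
    exact hφ3 n (s n) L (hL' (n + 1))

variable [IsAdicComplete (maximalIdeal T) T]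

/-- Existence of elements in prescribed affine families that are simultaneously transcendental over a
small subring modulo few primes. -/
theorem exists_mem_forall_isGenericMod {R : Subring T} (hR : IsSmall T #R) (𝒞 : Set (Ideal T))
    (h𝒞 : #𝒞 ≤ max ℵ₀ #R) (hprime : ∀ J ∈ 𝒞, J.IsPrime) (hmax : ∀ J ∈ 𝒞, J ≠ maximalIdeal T)
    (I : Ideal T) (hI : ∀ J ∈ 𝒞, ¬ I ≤ J) (a b : Ideal T → T) (hb : ∀ J ∈ 𝒞, b J ∉ J) :
    ∃ w ∈ I, ∀ J ∈ 𝒞, IsGenericMod R (a J + b J * w) J := by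
  let ι : Type u := {p : 𝒞 × R[X] // (p.2.map R.subtype).map (Ideal.Quotient.mk p.1.1) ≠ 0}
  have hι : #ι ≤ max ℵ₀ #R := by
    refine (mk_subtype_le _).trans ?_
    rw [mk_prod, lift_id, lift_id]
    have : #R[X] ≤ max ℵ₀ #R := by rw [max_comm]; exact Polynomial.cardinalMk_le_max
    exact (mul_le_mul' h𝒞 this).trans_eq (mul_eq_self (le_max_left _ _))
  have hsmall := hR.of_le_max hι
  obtain ⟨w, hw, h⟩ : ∃ w ∈ I, ∀ i : ι,
      ((i.1.2.map R.subtype).comp (C (a i.1.1) + C (b i.1.1) * X)).eval w ∉ i.1.1.1 := by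
    have h0 : ∀ i : ι, i.1.1.1.IsPrime := fun i => hprime _ i.1.1.2
    have h1 : ∀ i : ι, ((i.1.2.map R.subtype).comp
        (C (a i.1.1) + C (b i.1.1) * X)).map (Ideal.Quotient.mk i.1.1.1) ≠ 0 := fun i =>
      map_comp_ne_zero (h0 i) i.2 (n := 0) (by simpa using hb _ i.1.1.2)
    by_cases hc : #ι ≤ ℵ₀
    · have : Countable ι := mk_le_aleph0_iff.1 hc
      exact exists_mem_forall_eval_notMem_of_countable (fun i : ι => i.1.1.1) _ h0
        (fun i => hmax _ i.1.1.2) h1 I (fun i => hI _ i.1.1.2)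
    · refine exists_mem_forall_eval_notMem_of_lt (fun i : ι => i.1.1.1) _ h0 h1 I
        (fun i => hI _ i.1.1.2) ?_
      have h2 := hsmall.resolve_left hc
      exact max_lt ((not_le.1 hc).trans h2) h2
  refine ⟨w, hw, fun J hJ f hf n => ?_⟩
  by_contra hn
  refine h ⟨(⟨J, hJ⟩, f), fun h0 => hn ?_⟩ ?_
  · have := congrArg (fun p => p.coeff n) h0
    simpa [Ideal.Quotient.eq_zero_iff_mem] using this
  · simpa [eval_comp, eval_map, evalAt] using hf

end Precompletion

namespace Precompletion

open Polynomial Cardinal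

variable {T : Type u} [CommRing T]

theorem mem_span_of_le {R S : Subring T} (h : R ≤ S) {s : Set T} {c : T}
    (hc : c ∈ Submodule.span R s) : c ∈ Submodule.span S s := by
  induction hc using Submodule.span_induction with
  | mem x hx => exact Submodule.subset_span hx
  | zero => exact zero_mem _
  | add x y _ _ hx hy => exact add_mem hx hy
  | smul a x _ hx => exact Submodule.smul_mem _ (⟨a, h a.2⟩ : S) hx

theorem mem_span_image_mul_iff {A : Type*} [CommRing A] [Algebra A T] {q c : T} {s : Set T} :
    c ∈ Submodule.span A ((q * ·) '' s) ↔ ∃ d ∈ Submodule.span A s, c = q * d := by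
  have h : ((q * ·) '' s) = LinearMap.mulLeft A q '' s := rfl
  rw [h, Submodule.span_image, Submodule.mem_map]
  exact exists_congr fun d => and_congr_right fun _ => eq_comm

/-- A polynomial whose coefficients run through a given finite set. -/
theorem exists_polynomial_coeff_eq {R : Subring T} {s : Set T} (hs : s.Finite) :
    (∀ e ∈ s, e ∈ R) → ∃ f : R[X], (∀ e ∈ s, ∃ n, (f.coeff n : T) = e) ∧
      ∀ S : Subring T, ∀ z ∈ S, evalAt R z f ∈ Submodule.span S s := by
  induction s, hs using Set.Finite.induction_on with
  | empty => exact fun _ => ⟨0, by simp, by simp⟩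
  | @insert e s _ _ ih =>
    intro hR
    obtain ⟨f, hf, hfS⟩ := ih fun x hx => hR x (Set.mem_insert_of_mem _ hx)
    refine ⟨C ⟨e, hR e (Set.mem_insert _ _)⟩ + X * f, ?_, fun S z hz => ?_⟩
    · rintro x (rfl | hx)
      · exact ⟨0, by simp⟩
      · obtain ⟨n, hn⟩ := hf x hx
        exact ⟨n + 1, by simpa [coeff_C_succ] using hn⟩
    · simp only [map_add, map_mul, evalAt_C, evalAt_X]
      exact add_mem (Submodule.subset_span (Set.mem_insert _ _))
        (Submodule.smul_mem _ (⟨z, hz⟩ : S)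
          (Submodule.span_mono (Set.subset_insert _ _) (hfS S z hz)))

/-- The grade one primes meeting `R` nontrivially, the associated primes of `T`, and `P`. -/
def relevantPrimes (P : Ideal T) (R : Subring T) : Set (Ideal T) :=
  {J | IsGradeOnePrime J ∧ ∃ r ∈ R, r ≠ 0 ∧ r ∈ J} ∪ (associatedPrimes T T ∪ {P})

/-- A tame extension of subrings that does not increase infinite cardinalities. -/
structure IsStep (P : Ideal T) (R S : Subring T) : Prop where
  tame : IsTame P S
  extends_ : Extends R S
  card_le : #S ≤ max ℵ₀ #R

theorem IsTame.isStep_refl {P : Ideal T} {R : Subring T} (hR : IsTame P R) : IsStep P R R :=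
  ⟨hR, Extends.refl R, le_max_right _ _⟩

theorem IsStep.trans {P : Ideal T} {R S U : Subring T} (h : IsStep P R S) (h' : IsStep P S U) :
    IsStep P R U :=
  ⟨h'.tame, h.extends_.trans h'.extends_,
    h'.card_le.trans (max_le (le_max_left _ _) h.card_le)⟩

variable {P : Ideal T} {R : Subring T}

section IsNoetherianRing

variable [IsNoetherianRing T]

theorem IsTame.mk_relevantPrimes_le (hR : IsTame P R) : #(relevantPrimes P R) ≤ max ℵ₀ #R := by
  have h1 : {J | IsGradeOnePrime J ∧ ∃ r ∈ R, r ≠ 0 ∧ r ∈ J} ⊆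
      ⋃ r : {r : R // (r : T) ≠ 0}, {J | IsGradeOnePrime J ∧ (r : T) ∈ J} := by
    rintro J ⟨hJ, r, hr, hr0, hrJ⟩
    exact Set.mem_iUnion.2 ⟨⟨⟨r, hr⟩, hr0⟩, hJ, hrJ⟩
  have h2 : #{J | IsGradeOnePrime J ∧ ∃ r ∈ R, r ≠ 0 ∧ r ∈ J} ≤ max ℵ₀ #R := by
    refine (mk_le_mk_of_subset h1).trans ((mk_iUnion_le _).trans ?_)
    refine (mul_le_mul' ((mk_subtype_le _).trans (le_max_right ℵ₀ _))
      ((ciSup_le' fun r => ?_).trans (le_max_left ℵ₀ #R))).trans_eq (mul_eq_self (le_max_left _ _))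
    exact (lt_aleph0_iff_set_finite.2 (finite_isGradeOnePrime_mem
      (hR.regular _ r.1.2 r.2))).le
  have h3 : #(associatedPrimes T T ∪ {P} : Set (Ideal T)) ≤ max ℵ₀ #R :=
    (lt_aleph0_iff_set_finite.2 ((associatedPrimes.finite T T).union
      (Set.finite_singleton P))).le.trans (le_max_left _ _)
  exact (mk_union_le _ _).trans
    ((add_le_add h2 h3).trans_eq (add_eq_self (le_max_left _ _)))

theorem IsTame.notMem_of_mem_relevantPrimes (hR : IsTame P R) {b : T} (hb : b ∈ R) (hb0 : b ≠ 0)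
    {J : Ideal T} (hJ : J ∈ relevantPrimes P R) (h : IsGradeOnePrime J → b ∉ J) : b ∉ J := by
  rcases hJ with hJ | hJ | hJ
  · exact h hJ.1
  · exact notMem_of_mem_nonZeroDivisors (hR.regular b hb hb0) hJ
  · rw [Set.mem_singleton_iff.1 hJ]
    exact hR.notMem b hb hb0

theorem IsTame.isStep_adjoinSat (hR : IsTame P R) {x : T}
    (hx : ∀ Q, Q ∈ associatedPrimes T T ∨ Q = P → IsGenericMod R x Q)
    (hx' : ∀ J, IsGradeOnePrime J → ∀ q, q ≠ 0 → IsGenerator R J q →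
      ∃ x', adjoinSat R x' = adjoinSat R x ∧
        ∀ J', IsGradeOnePrime J' → IsGenerator R J' q → IsGenericMod R x' J') :
    IsStep P R (adjoinSat R x) := by
  have key : ∀ Q, Q ∈ associatedPrimes T T ∨ Q = P → ∀ f : R[X], f ≠ 0 → evalAt R x f ∉ Q := by
    intro Q hQ f hf h
    have hlc : ((f.coeff f.natDegree : R) : T) ≠ 0 := by
      simpa using hf
    have := hx Q hQ f h f.natDegree
    rcases hQ with hQ | rfl
    · exact notMem_of_mem_nonZeroDivisors (hR.regular _ (Subtype.prop _) hlc) hQ this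
    · exact hR.notMem _ (Subtype.prop _) hlc this
  obtain ⟨h1, h2⟩ := hR.isTame_and_extends_adjoinSat
    (fun f hf => mem_nonZeroDivisors_of_forall_notMem fun Q hQ => key Q (Or.inl hQ) f hf)
    (key P (Or.inr rfl)) hx'
  exact ⟨h1, h2, mk_adjoinSat_le R x⟩

end IsNoetherianRing

variable [IsLocalRing T]

/-- The nonmaximality conditions on the primes to be avoided. -/
structure IsAdmissible (P : Ideal T) : Prop where
  isPrime : P.IsPrime
  ne_maximalIdeal : P ≠ maximalIdeal T
  not_isGradeOnePrime : ¬ IsGradeOnePrime (maximalIdeal T)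
  notMem_associatedPrimes : maximalIdeal T ∉ associatedPrimes T T

theorem IsAdmissible.isPrime_of_mem (hP : IsAdmissible P) {J : Ideal T}
    (hJ : J ∈ relevantPrimes P R) : J.IsPrime := by
  rcases hJ with hJ | hJ | hJ
  · exact hJ.1.isPrime
  · exact IsAssociatedPrime.isPrime hJ
  · rw [Set.mem_singleton_iff.1 hJ]
    exact hP.isPrime

theorem IsAdmissible.ne_of_mem (hP : IsAdmissible P) {J : Ideal T}
    (hJ : J ∈ relevantPrimes P R) : J ≠ maximalIdeal T := by
  rintro rfl
  rcases hJ with hJ | hJ | hJ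
  · exact hP.not_isGradeOnePrime hJ.1
  · exact hP.notMem_associatedPrimes hJ
  · exact hP.ne_maximalIdeal (Set.mem_singleton_iff.1 hJ).symm

variable [IsNoetherianRing T] [IsAdicComplete (maximalIdeal T) T]

theorem IsTame.exists_isGenericMod (hR : IsTame P R) (hP : IsAdmissible P) (hc : IsSmall T #R)
    (I : Ideal T) (hI : ∀ J ∈ relevantPrimes P R, ¬ I ≤ J) (a b : Ideal T → T)
    (hb : ∀ J ∈ relevantPrimes P R, b J ∉ J) :
    ∃ w ∈ I, ∀ J ∈ relevantPrimes P R, IsGenericMod R (a J + b J * w) J :=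
  exists_mem_forall_isGenericMod hc _ hR.mk_relevantPrimes_le (fun _ => hP.isPrime_of_mem)
    (fun _ => hP.ne_of_mem) I hI a b hb

theorem IsTame.exists_isStep (hR : IsTame P R) (hP : IsAdmissible P) (hc : IsSmall T #R) (u : T)
    (I : Ideal T) (hI : ∀ J ∈ relevantPrimes P R, ¬ I ≤ J) :
    ∃ w ∈ I, IsStep P R (adjoinSat R (u + w)) ∧
      ∀ J ∈ relevantPrimes P R, IsGenericMod R (u + w) J := by
  obtain ⟨w, hw, h⟩ := hR.exists_isGenericMod hP hc I hI (fun _ => u) (fun _ => 1)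
    fun J hJ => (Ideal.ne_top_iff_one J).1 (hP.isPrime_of_mem hJ).ne_top
  simp only [one_mul] at h
  refine ⟨w, hw, hR.isStep_adjoinSat (fun Q hQ => h Q (Or.inr hQ)) fun J _ q hq _ =>
    ⟨u + w, rfl, fun J' hJ' hg => h J' (Or.inl ⟨hJ', q, hg.mem, hq, hg.mem_ideal⟩)⟩, h⟩

/-- Elements can be approximated modulo powers of the maximal ideal by elements of small tame
extensions. -/
theorem IsTame.exists_isStep_sub_mem_pow (hR : IsTame P R) (hP : IsAdmissible P)
    (hc : IsSmall T #R) (u : T) (n : ℕ) :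
    ∃ S, IsStep P R S ∧ ∃ x ∈ S, x - u ∈ maximalIdeal T ^ n := by
  obtain ⟨w, hw, h, -⟩ := hR.exists_isStep hP hc u (maximalIdeal T ^ n) fun J hJ hle => by
    have := hP.isPrime_of_mem hJ
    exact hP.ne_of_mem hJ (le_antisymm (le_maximalIdeal this.ne_top) (this.le_of_pow_le hle))
  exact ⟨_, h, u + w, self_mem_adjoinSat _ _, by simpa using hw⟩

theorem IsTame.exists_isStep_mem_span_pair (hR : IsTame P R) (hP : IsAdmissible P)
    (hc : IsSmall T #R) {a b c : T} (ha : a ∈ R) (hb : b ∈ R) (hcR : c ∈ R) (hb0 : b ≠ 0)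
    (hab : ∀ J, IsGradeOnePrime J → a ∈ J → b ∉ J) (h : c ∈ Ideal.span {a, b}) :
    ∃ S, IsStep P R S ∧ c ∈ Submodule.span S {a, b} := by
  obtain ⟨s₀, t₀, rfl⟩ := Ideal.mem_span_pair.1 h
  have hmem : ∀ S : Subring T, ∀ s ∈ S, ∀ t ∈ S, s * a + t * b ∈ Submodule.span S {a, b} :=
    fun S s hs t ht => Submodule.mem_span_pair.2 ⟨⟨s, hs⟩, ⟨t, ht⟩, rfl⟩
  by_cases ha0 : a = 0
  · refine ⟨R, hR.isStep_refl, ?_⟩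
    have : t₀ ∈ R := hR.mem_of_mul_mem b hb hb0 _ (by simpa [ha0, mul_comm] using hcR)
    simpa [ha0] using hmem R 0 R.zero_mem t₀ this
  classical
  obtain ⟨w, -, hw⟩ := hR.exists_isGenericMod hP hc ⊤
    (fun J hJ hle => (hP.isPrime_of_mem hJ).ne_top (top_le_iff.1 hle))
    (fun J => if b ∈ J then t₀ else s₀) (fun J => if b ∈ J then -a else b) fun J hJ => by
      split_ifs with hbJ
      · rw [neg_mem_iff]
        exact hR.notMem_of_mem_relevantPrimes ha ha0 hJ fun hJ' haJ => hab J hJ' haJ hbJ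
      · exact hbJ
  set s := s₀ + b * w with hs
  set t := t₀ + -a * w with ht
  have hst : s₀ * a + t₀ * b = s * a + t * b := by rw [hs, ht]; ring
  have hwb : ∀ J ∈ relevantPrimes P R, b ∉ J → IsGenericMod R s J := fun J hJ hbJ => by
    simpa [hbJ] using hw J hJ
  have hwb' : ∀ J ∈ relevantPrimes P R, b ∈ J → IsGenericMod R t J := fun J hJ hbJ => by
    simpa only [if_pos hbJ] using hw J hJ
  have hts : t ∈ adjoinSat R s := by
    refine mem_saturation_of_mul_mem (le_adjoinSat R s hb) (hR.regular b hb hb0) ?_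
    have : b * t = (s₀ * a + t₀ * b) - s * a := by rw [hst]; ring
    rw [this]
    exact Subring.sub_mem _ (le_adjoinSat R s hcR)
      (Subring.mul_mem _ (self_mem_adjoinSat R s) (le_adjoinSat R s ha))
  have hst' : s ∈ adjoinSat R t := by
    refine mem_saturation_of_mul_mem (le_adjoinSat R t ha) (hR.regular a ha ha0) ?_
    have : a * s = (s₀ * a + t₀ * b) - t * b := by rw [hst]; ring
    rw [this]
    exact Subring.sub_mem _ (le_adjoinSat R t hcR)
      (Subring.mul_mem _ (self_mem_adjoinSat R t) (le_adjoinSat R t hb))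
  refine ⟨adjoinSat R s, hR.isStep_adjoinSat (fun Q hQ => ?_) fun J hJ q hq hg => ?_, ?_⟩
  · refine hwb Q (Or.inr hQ) ?_
    rcases hQ with hQ | rfl
    · exact notMem_of_mem_nonZeroDivisors (hR.regular b hb hb0) hQ
    · exact hR.notMem b hb hb0
  · by_cases hbJ : b ∈ J
    · refine ⟨t, le_antisymm (adjoinSat_le hts) (adjoinSat_le hst'), fun J' hJ' hg' => ?_⟩
      refine hwb' J' (Or.inl ⟨hJ', q, hg.mem, hq, hg'.mem_ideal⟩) ?_
      obtain ⟨v, -, rfl⟩ := hg.exists_eq_mul b hb hbJ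
      exact J'.mul_mem_right _ hg'.mem_ideal
    · refine ⟨s, rfl, fun J' hJ' hg' => ?_⟩
      refine hwb J' (Or.inl ⟨hJ', q, hg.mem, hq, hg'.mem_ideal⟩) fun hbJ' => hbJ ?_
      obtain ⟨v, -, rfl⟩ := hg'.exists_eq_mul b hb hbJ'
      exact J.mul_mem_right _ hg.mem_ideal
  · rw [hst]
    exact hmem _ s (self_mem_adjoinSat R s) t hts

theorem exists_isStep_mem_span_union (hP : IsAdmissible P) {a b : T} (hb0 : b ≠ 0)
    (hab : ∀ J, IsGradeOnePrime J → a ∈ J → b ∉ J) {s : Set T} (hs : s.Finite) :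
    ∀ R : Subring T, IsTame P R → IsSmall T #R → a ∈ R → b ∈ R → (∀ e ∈ s, e ∈ R) →
      ∀ c ∈ R, c ∈ Ideal.span (s ∪ {a, b}) →
        ∃ S, IsStep P R S ∧ c ∈ Submodule.span S (s ∪ {a, b}) := by
  induction s, hs using Set.Finite.induction_on with
  | empty =>
    intro R hR hc ha hb _ c hcR h
    rw [Set.empty_union] at h ⊢
    exact hR.exists_isStep_mem_span_pair hP hc ha hb hcR hb0 hab h
  | @insert e s _ _ ih =>
    intro R hR hc ha hb hsR c hcR h
    rw [Set.insert_union] at h ⊢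
    obtain ⟨t, z, hz, rfl⟩ := Ideal.mem_span_insert.1 h
    have ha' : a ∈ ({a, b} : Set T) := by simp
    have hb' : b ∈ ({a, b} : Set T) := by simp
    obtain ⟨w, hw, hstep, -⟩ := hR.exists_isStep hP hc t (Ideal.span {a, b}) fun J hJ hle =>
      hR.notMem_of_mem_relevantPrimes hb hb0 hJ
        (fun hJ' => hab J hJ' (hle (Ideal.subset_span ha'))) (hle (Ideal.subset_span hb'))
    have hle := hstep.extends_.le
    have he := hsR e (Set.mem_insert _ _)
    have ht := self_mem_adjoinSat R (t + w)
    obtain ⟨S, hS, hmem⟩ := ih _ hstep.tame (hc.of_le_max hstep.card_le) (hle ha) (hle hb)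
      (fun x hx => hle (hsR x (Set.mem_insert_of_mem _ hx))) (z - w * e) (by
        have : z - w * e = (t * e + z) - (t + w) * e := by ring
        rw [this]
        exact Subring.sub_mem _ (hle hcR) (Subring.mul_mem _ ht (hle he)))
      (sub_mem hz (Ideal.mul_mem_right _ _ (Ideal.span_mono Set.subset_union_right hw)))
    refine ⟨S, hstep.trans hS, ?_⟩
    have : t * e + z = (⟨t + w, hS.extends_.le ht⟩ : S) • e + (z - w * e) := by
      rw [Subring.smul_def, smul_eq_mul]
      ring
    rw [this]
    exact Submodule.mem_span_insert.2 ⟨_, _, hmem, rfl⟩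

/-- Solving linear equations in small tame extensions: the case without common factors. -/
theorem IsTame.exists_isStep_mem_span_of_primitive (hR : IsTame P R) (hP : IsAdmissible P)
    (hc : IsSmall T #R) {s : Set T} (hs : s.Finite) (hsR : ∀ e ∈ s, e ∈ R) {b : T} (hb : b ∈ s)
    (hb0 : b ≠ 0) (hprim : ∀ J, IsGradeOnePrime J → ∃ e ∈ s, e ∉ J) {c : T} (hcR : c ∈ R)
    (h : c ∈ Ideal.span s) : ∃ S, IsStep P R S ∧ c ∈ Submodule.span S s := by
  obtain ⟨f, hf, hfS⟩ := exists_polynomial_coeff_eq hs hsR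
  obtain ⟨z, -, hstep, hz⟩ := hR.exists_isStep hP hc 0 ⊤
    fun J hJ hle => (hP.isPrime_of_mem hJ).ne_top (top_le_iff.1 hle)
  have hle := hstep.extends_.le
  obtain ⟨S, hS, hcS⟩ := exists_isStep_mem_span_union hP (a := evalAt R (0 + z) f) hb0
    (fun J hJ haJ hbJ => by
      obtain ⟨e, he, heJ⟩ := hprim J hJ
      obtain ⟨n, rfl⟩ := hf e he
      exact heJ <| hz J (Or.inl ⟨hJ, b, hsR b hb, hb0, hbJ⟩) f haJ n)
    hs _ hstep.tame (hc.of_le_max hstep.card_le) (evalAt_mem_adjoinSat _ _ _) (hle (hsR b hb))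
    (fun e he => hle (hsR e he)) c (hle hcR) (Ideal.span_mono Set.subset_union_left h)
  refine ⟨S, hstep.trans hS, ?_⟩
  refine Submodule.span_le.2 (Set.union_subset Submodule.subset_span ?_) hcS
  rintro _ (rfl | rfl)
  · exact hfS S _ (hS.extends_.le (self_mem_adjoinSat _ _))
  · exact Submodule.subset_span hb

/-- Solving linear equations in small tame extensions. -/
theorem IsTame.exists_isStep_mem_span (hR : IsTame P R) (hP : IsAdmissible P)
    (hc : IsSmall T #R) {s : Set T} (hs : s.Finite) (hsR : ∀ e ∈ s, e ∈ R) {c : T} (hcR : c ∈ R)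
    (h : c ∈ Ideal.span s) : ∃ S, IsStep P R S ∧ c ∈ Submodule.span S s := by
  by_cases hz : ∀ b ∈ s, b = 0
  · have : c = 0 := by
      have h0 : Ideal.span s ≤ ⊥ := Ideal.span_le.2 fun b hb => by simp [hz b hb]
      simpa using h0 h
    exact ⟨R, hR.isStep_refl, this ▸ zero_mem _⟩
  push Not at hz
  obtain ⟨b, hb, hb0⟩ := hz
  induction hI : Ideal.span {b} using WellFoundedGT.induction generalizing b s c with
  | ind I ih =>
    subst hI
    by_cases hprim : ∀ J, IsGradeOnePrime J → ∃ e ∈ s, e ∉ J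
    · exact hR.exists_isStep_mem_span_of_primitive hP hc hs hsR hb hb0 hprim hcR h
    push Not at hprim
    obtain ⟨J, hJ, hsJ⟩ := hprim
    obtain ⟨q, hq⟩ := hR.exists_generator J hJ
    obtain ⟨b', hb', rfl⟩ := hq.exists_eq_mul b (hsR b hb) (hsJ b hb)
    have hq0 : q ≠ 0 := left_ne_zero_of_mul hb0
    have hb0' : b' ≠ 0 := right_ne_zero_of_mul hb0
    have hqr := hR.regular q hq.mem hq0
    have himage : (q * ·) '' ((q * ·) ⁻¹' s) = s :=
      Set.image_preimage_eq_of_subset fun e he => by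
        obtain ⟨w, -, rfl⟩ := hq.exists_eq_mul e (hsR e he) (hsJ e he)
        exact ⟨w, rfl⟩
    rw [← himage] at h
    obtain ⟨c', hc', rfl⟩ := mem_span_image_mul_iff.1 h
    obtain ⟨S, hS, hmem⟩ := ih _ (span_lt_span_of_eq_mul (hR.regular b' hb' hb0')
        (hJ.not_isUnit hq.mem_ideal) rfl)
      (hs.preimage fun _ _ _ _ => mul_left_cancel_of_nzd hqr)
      (fun e he => hR.mem_of_mul_mem q hq.mem hq0 e (hsR _ he))
      (hR.mem_of_mul_mem q hq.mem hq0 c' hcR) hc' b' hb hb0' rfl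
    refine ⟨S, hS, ?_⟩
    rw [← himage]
    exact mem_span_image_mul_iff.2 ⟨c', hmem, rfl⟩

end Precompletion

namespace Precompletion

open Polynomial Cardinal

variable {T : Type u} [CommRing T]

/-- Directed unions of tame subrings are tame. -/
theorem isTame_iSup {P : Ideal T} {κ : Type*} [Nonempty κ] {R : κ → Subring T}
    (hR : ∀ i, IsTame P (R i)) (hdir : ∀ i j, ∃ k, Extends (R i) (R k) ∧ Extends (R j) (R k)) :
    IsTame P (⨆ i, R i) ∧ ∀ i, Extends (R i) (⨆ i, R i) := by
  have hmem : ∀ {x : T}, x ∈ ⨆ i, R i ↔ ∃ i, x ∈ R i := fun {x} =>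
    Subring.mem_iSup_of_directed fun i j => (hdir i j).imp fun k hk => ⟨hk.1.le, hk.2.le⟩
  have hgen : ∀ i, ∀ J, IsGradeOnePrime J → ∀ q, q ≠ 0 → IsGenerator (R i) J q →
      IsGenerator (⨆ i, R i) J q := by
    refine fun i J hJ q hq hg => ⟨hmem.2 ⟨i, hg.mem⟩, hg.mem_ideal, fun z hz hzJ => ?_⟩
    obtain ⟨j, hj⟩ := hmem.1 hz
    obtain ⟨k, hik, hjk⟩ := hdir i j
    obtain ⟨w, hw, e⟩ := (hik.generator J hJ q hq hg).exists_eq_mul z (hjk.le hj) hzJ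
    exact ⟨w, hmem.2 ⟨k, hw⟩, e⟩
  refine ⟨⟨fun r hr => ?_, fun r hr => ?_, fun z hz hz0 v hv => ?_, fun J hJ => ?_⟩,
    fun i => ⟨le_iSup R i, hgen i⟩⟩
  · obtain ⟨i, hi⟩ := hmem.1 hr
    exact (hR i).regular r hi
  · obtain ⟨i, hi⟩ := hmem.1 hr
    exact (hR i).notMem r hi
  · obtain ⟨i, hi⟩ := hmem.1 hz
    obtain ⟨j, hj⟩ := hmem.1 hv
    obtain ⟨k, hik, hjk⟩ := hdir i j
    exact hmem.2 ⟨k, (hR k).mem_of_mul_mem z (hik.le hi) hz0 v (hjk.le hj)⟩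
  · by_cases h : ∃ i, ∃ r ∈ R i, r ≠ 0 ∧ r ∈ J
    · obtain ⟨i, r, hr, hr0, hrJ⟩ := h
      obtain ⟨q, hq⟩ := (hR i).exists_generator J hJ
      refine ⟨q, hgen i J hJ q ?_ hq⟩
      rintro rfl
      obtain ⟨w, -, e⟩ := hq.exists_eq_mul r hr hrJ
      exact hr0 (by simpa using e)
    · push Not at h
      refine ⟨0, Subring.zero_mem _, J.zero_mem, fun z hz hzJ => ?_⟩
      obtain ⟨i, hi⟩ := hmem.1 hz
      have : z = 0 := by
        by_contra h0
        exact h i z hi h0 hzJ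
      exact ⟨0, Subring.zero_mem _, by simp [this]⟩

theorem mk_iSup_le {κ : Type u} [Nonempty κ] {R : κ → Subring T} (hdir : Directed (· ≤ ·) R)
    {c : Cardinal.{u}} (hc : ℵ₀ ≤ c) (hκ : #κ ≤ c) (hR : ∀ i, #(R i) ≤ c) :
    #(⨆ i, R i : Subring T) ≤ c := by
  have h : ((⨆ i, R i : Subring T) : Set T) = ⋃ i, (R i : Set T) :=
    Set.ext fun x => by simp [Subring.mem_iSup_of_directed hdir]
  calc #((⨆ i, R i : Subring T) : Set T) ≤ #κ * ⨆ i, #(R i : Set T) := h ▸ mk_iUnion_le _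
    _ ≤ c * c := mul_le_mul' hκ (ciSup_le' hR)
    _ = c := mul_eq_self hc

theorem exists_surjective_of_mk_le {α ι : Type u} [Nonempty α] (h : #α ≤ #ι) :
    ∃ g : ι → α, Function.Surjective g := by
  obtain ⟨e⟩ := h
  exact ⟨Function.invFun e, Function.invFun_surjective e.injective⟩

/-- A function on a well-ordered set without large initial segments taking every value cofinally. -/
theorem exists_forall_exists_gt_eq {ι : Type u} [LinearOrder ι] (hι : ℵ₀ ≤ #ι)
    (hlt : ∀ i : ι, #(Set.Iio i) < #ι) :
    ∃ e : ι → ι × ι, ∀ p : ι × ι, ∃ i, p.1 < i ∧ e i = p := by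
  have hcard : #ι = #((ι × ι) × ι) := by
    simp only [mk_prod, lift_id]
    rw [mul_eq_self hι, mul_eq_self hι]
  obtain ⟨φ⟩ := Cardinal.eq.1 hcard
  refine ⟨fun i => (φ i).1, fun p => ?_⟩
  by_contra! h
  have hsub : Set.range (fun δ => φ.symm (p, δ)) ⊆ Set.Iio p.1 ∪ {p.1} := by
    rintro _ ⟨δ, rfl⟩
    have := fun h' => h (φ.symm (p, δ)) h' (by simp)
    rcases (not_lt.1 this).lt_or_eq with h1 | h1
    · exact Or.inl h1
    · exact Or.inr h1
  have h1 : #ι ≤ #(Set.Iio p.1 ∪ {p.1} : Set ι) := by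
    rw [← mk_range_eq (fun δ => φ.symm (p, δ)) fun a b hab => by simpa using hab]
    exact mk_le_mk_of_subset hsub
  refine (h1.trans (mk_union_le _ _)).not_gt (add_lt_of_lt hι (hlt _) ?_)
  exact (lt_aleph0_iff_set_finite.2 (Set.finite_singleton _)).trans_le hι

/-- Finite subsets with a marked element of sets of bounded size can be enumerated uniformly. -/
theorem exists_enumeration {ι : Type u} (hι : ℵ₀ ≤ #ι) :
    ∃ τ : Subring T → ι → Finset T × T, ∀ R : Subring T, #R ≤ #ι →
      ∀ s : Finset T, (∀ e ∈ s, e ∈ R) → ∀ c ∈ R, ∃ γ, τ R γ = (s, c) := by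
  classical
  have : Infinite ι := infinite_iff.2 hι
  have key : ∀ R : Subring T, ∃ τ : ι → Finset T × T, #R ≤ #ι →
      ∀ s : Finset T, (∀ e ∈ s, e ∈ R) → ∀ c ∈ R, ∃ γ, τ γ = (s, c) := by
    intro R
    by_cases hR : #R ≤ #ι
    · have hcard : #(Finset R × R) ≤ #ι := by
        rw [mk_prod, lift_id, lift_id, ← mul_eq_self hι]
        obtain ⟨e⟩ := hR
        refine mul_le_mul' ?_ (mk_le_of_injective e.injective)
        rw [← mk_finset_of_infinite ι]
        exact mk_le_of_injective (Finset.map_injective e)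
      obtain ⟨g, hg⟩ := exists_surjective_of_mk_le hcard
      refine ⟨fun γ => ((g γ).1.map (Function.Embedding.subtype _), (g γ).2), fun _ s hs c hc => ?_⟩
      obtain ⟨γ, hγ⟩ := hg (s.subtype (· ∈ R), ⟨c, hc⟩)
      refine ⟨γ, ?_⟩
      simp only [hγ, Prod.mk.injEq, and_true]
      exact Finset.subtype_map_of_mem hs
    · exact ⟨fun _ => (∅, 0), fun h => absurd h hR⟩
  choose τ hτ using key
  exact ⟨τ, hτ⟩

variable [IsLocalRing T] [IsNoetherianRing T] [IsAdicComplete (maximalIdeal T) T]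

/-- One stage of the construction: approximate an element and solve a linear equation. -/
theorem exists_stage {P : Ideal T} (hP : IsAdmissible P) (R : Subring T) (u : T)
    (p : Finset T × T) : ∃ S : Subring T, IsTame P R → IsSmall T #R →
      IsStep P R S ∧ (∃ x ∈ S, x - u ∈ maximalIdeal T ^ 2) ∧
        ((∀ e ∈ p.1, e ∈ R) → p.2 ∈ R → p.2 ∈ Ideal.span (p.1 : Set T) →
          p.2 ∈ Submodule.span S (p.1 : Set T)) := by
  by_cases hR : IsTame P R ∧ IsSmall T #R
  · obtain ⟨hR, hc⟩ := hR
    obtain ⟨S, hS, x, hx, hxu⟩ := hR.exists_isStep_sub_mem_pow hP hc u 2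
    by_cases h : (∀ e ∈ p.1, e ∈ R) ∧ p.2 ∈ R ∧ p.2 ∈ Ideal.span (p.1 : Set T)
    · obtain ⟨S', hS', h'⟩ := hS.tame.exists_isStep_mem_span hP (hc.of_le_max hS.card_le)
        p.1.finite_toSet (fun e he => hS.extends_.le (h.1 e he)) (hS.extends_.le h.2.1) h.2.2
      exact ⟨S', fun _ _ => ⟨hS.trans hS', ⟨x, hS'.extends_.le hx, hxu⟩, fun _ _ _ => h'⟩⟩
    · exact ⟨S, fun _ _ => ⟨hS, ⟨x, hx, hxu⟩, fun h1 h2 h3 => absurd ⟨h1, h2, h3⟩ h⟩⟩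
  · exact ⟨R, fun h1 h2 => absurd ⟨h1, h2⟩ hR⟩

/-- A tame subring that approximates a prescribed set and in which linear equations that are
solvable in `T` are solvable. -/
theorem exists_isTame_closed {P : Ideal T} (hP : IsAdmissible P) {R₀ : Subring T}
    (hR₀ : IsTame P R₀) (hR₀c : #R₀ ≤ ℵ₀) {𝒰 : Set T} (h𝒰 : #𝒰 ≤ max ℵ₀ #(ResidueField T))
    (hne : 𝒰.Nonempty) :
    ∃ A : Subring T, R₀ ≤ A ∧ IsTame P A ∧
      (∀ u ∈ 𝒰, ∃ x ∈ A, x - u ∈ maximalIdeal T ^ 2) ∧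
      ∀ s : Finset T, (∀ e ∈ s, e ∈ A) → ∀ c ∈ A, c ∈ Ideal.span (s : Set T) →
        c ∈ Submodule.span A (s : Set T) := by
  classical
  let ι : Type u := (max ℵ₀ #(ResidueField T)).ord.ToType
  have hιc : #ι = max ℵ₀ #(ResidueField T) := mk_ord_toType _
  have hι : ℵ₀ ≤ #ι := hιc ▸ le_max_left _ _
  have hlt : ∀ i : ι, #(Set.Iio i) < #ι := fun i =>
    mk_Iio_lt i (by rw [hιc, Ordinal.type_toType])
  have hsmall : ∀ i : ι, IsSmall T (max ℵ₀ #(Set.Iio i)) := by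
    intro i
    rcases le_or_gt #(Set.Iio i) ℵ₀ with h | h
    · exact Or.inl (max_le le_rfl h)
    · right
      have h1 := hιc ▸ hlt i
      rw [max_eq_right h.le]
      rcases lt_max_iff.1 h1 with h2 | h2
      · exact absurd h2 h.not_gt
      · exact h2
  have : Nonempty ι := mk_ne_zero_iff.1 (aleph0_pos.trans_le hι).ne'
  have : Nonempty 𝒰 := hne.to_subtype
  obtain ⟨u, hu⟩ := exists_surjective_of_mk_le (α := 𝒰) (ι := ι) (hιc ▸ h𝒰)
  obtain ⟨e, he⟩ := exists_forall_exists_gt_eq hι hlt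
  obtain ⟨τ, hτ⟩ := exists_enumeration (T := T) hι
  choose stage hstage using exists_stage hP
  let G : (i : ι) → ((j : ι) → j < i → Subring T) → Subring T := fun i g =>
    stage (⨆ o : Option (Set.Iio i), o.elim R₀ fun j => g j j.2) (u i)
      (if h : (e i).1 < i then τ (g (e i).1 h) (e i).2 else (∅, 0))
  let f : ι → Subring T := wellFounded_lt.fix G
  let U : ι → Subring T := fun i => ⨆ o : Option (Set.Iio i), o.elim R₀ fun j => f j
  have hf : ∀ i, f i = stage (U i) (u i)
      (if (e i).1 < i then τ (f (e i).1) (e i).2 else (∅, 0)) := fun i => by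
    simp only [f]
    rw [WellFounded.fix_eq]
    simp only [G, U, f, dite_eq_ite]
  have hinv : ∀ i, (IsTame P (U i) ∧ IsSmall T #(U i) ∧ ∀ j < i, Extends (f j) (U i)) ∧
      Extends R₀ (U i) ∧ #(U i) ≤ max ℵ₀ #(Set.Iio i) := by
    intro i
    induction i using WellFoundedLT.induction with
    | ind i ih =>
    have hst : ∀ j < i, IsStep P (U j) (f j) := fun j hj => by
      rw [hf j]
      exact (hstage _ _ _ (ih j hj).1.1 (ih j hj).1.2.1).1
    have hR₀f : ∀ j < i, Extends R₀ (f j) := fun j hj => (ih j hj).2.1.trans (hst j hj).extends_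
    have hff : ∀ j < i, ∀ k ≤ j, Extends (f k) (f j) := fun j hj k hk => by
      rcases hk.lt_or_eq with hk | rfl
      · exact ((ih j hj).1.2.2 k hk).trans (hst j hj).extends_
      · exact Extends.refl _
    have hdir : ∀ o o' : Option (Set.Iio i), ∃ o'' : Option (Set.Iio i),
        Extends (o.elim R₀ fun j => f j) (o''.elim R₀ fun j => f j) ∧
        Extends (o'.elim R₀ fun j => f j) (o''.elim R₀ fun j => f j) := by
      rintro (_ | j) (_ | k)
      · exact ⟨none, Extends.refl _, Extends.refl _⟩
      · exact ⟨some k, hR₀f k k.2, Extends.refl _⟩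
      · exact ⟨some j, Extends.refl _, hR₀f j j.2⟩
      · rcases le_total j k with h | h
        · exact ⟨some k, hff k k.2 j h, Extends.refl _⟩
        · exact ⟨some j, Extends.refl _, hff j j.2 k h⟩
    obtain ⟨h1, h2⟩ := isTame_iSup (P := P) (R := fun o : Option (Set.Iio i) =>
      o.elim R₀ fun j => f j) (by
        rintro (_ | j)
        · exact hR₀
        · exact (hst j j.2).tame) hdir
    have h3 : #(U i) ≤ max ℵ₀ #(Set.Iio i) := by
      refine mk_iSup_le (fun o o' => (hdir o o').imp fun k hk => ⟨hk.1.le, hk.2.le⟩)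
        (le_max_left _ _) ?_ ?_
      · rw [mk_option]
        exact (add_le_add (le_max_right _ _) (one_le_aleph0.trans (le_max_left _ _))).trans_eq
          (add_eq_self (le_max_left _ _))
      · rintro (_ | j)
        · exact hR₀c.trans (le_max_left _ _)
        · refine (hst j j.2).card_le.trans (max_le (le_max_left _ _) ((ih j j.2).2.2.trans ?_))
          exact max_le_max le_rfl (mk_le_mk_of_subset (Set.Iio_subset_Iio (le_of_lt j.2)))
    exact ⟨⟨h1, (hsmall i).of_le_max (h3.trans (le_max_right _ _)), fun j hj => h2 (some ⟨j, hj⟩)⟩,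
      h2 none, h3⟩
  have hst := fun i => hf i ▸ hstage _ _ _ (hinv i).1.1 (hinv i).1.2.1
  have hff : ∀ j, ∀ k ≤ j, Extends (f k) (f j) := fun j k hk => by
    rcases hk.lt_or_eq with hk | rfl
    · exact ((hinv j).1.2.2 k hk).trans (hst j).1.extends_
    · exact Extends.refl _
  have hfc : ∀ i, #(f i) ≤ #ι := fun i =>
    (hst i).1.card_le.trans (max_le hι ((hinv i).2.2.trans (max_le hι (hlt i).le)))
  obtain ⟨hA, hfA⟩ := isTame_iSup (P := P) (R := f) (fun i => (hst i).1.tame) fun i j =>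
    ⟨max i j, hff _ _ (le_max_left _ _), hff _ _ (le_max_right _ _)⟩
  have hmem : ∀ {x : T}, x ∈ ⨆ i, f i ↔ ∃ i, x ∈ f i := fun {x} =>
    Subring.mem_iSup_of_directed fun i j =>
      ⟨max i j, (hff _ _ (le_max_left _ _)).le, (hff _ _ (le_max_right _ _)).le⟩
  refine ⟨⨆ i, f i, ?_, hA, fun v hv => ?_, fun s hs c hc hcs => ?_⟩
  · obtain ⟨i⟩ := ‹Nonempty ι›
    exact (((hinv i).2.1.trans (hst i).1.extends_).trans (hfA i)).le
  · obtain ⟨i, hi⟩ := hu ⟨v, hv⟩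
    obtain ⟨x, hx, hxu⟩ := (hst i).2.1
    exact ⟨x, (hfA i).le hx, by simpa [hi] using hxu⟩
  · have hidx : ∀ x : T, ∃ i, x ∈ ⨆ i, f i → x ∈ f i := fun x => by
      by_cases hx : x ∈ ⨆ i, f i
      · exact (hmem.1 hx).imp fun i hi _ => hi
      · exact ⟨Classical.arbitrary ι, fun h => absurd h hx⟩
    choose idx hidx using hidx
    obtain ⟨β, hβ⟩ := ((insert c s).image idx).exists_le
    have hβ' : ∀ x ∈ insert c s, x ∈ ⨆ i, f i → x ∈ f β := fun x hx hxA =>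
      (hff β _ (hβ _ (Finset.mem_image_of_mem _ hx))).le (hidx x hxA)
    have hs' : ∀ x ∈ s, x ∈ f β := fun x hx => hβ' x (Finset.mem_insert_of_mem hx) (hs x hx)
    have hc' : c ∈ f β := hβ' c (Finset.mem_insert_self _ _) hc
    obtain ⟨γ, hγ⟩ := hτ (f β) (hfc β) s hs' c hc'
    obtain ⟨i, hi, hei⟩ := he (β, γ)
    have h := (hst i).2.2
    rw [hei, if_pos hi, hγ] at h
    have hle := ((hinv i).1.2.2 β hi).le
    exact mem_span_of_le (hfA i).le (h (fun x hx => hle (hs' x hx)) (hle hc') hcs)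

end Precompletion

namespace Precompletion

open Polynomial Cardinal

variable {T : Type u} [CommRing T]

section Base

theorem eq_zero_or_isUnit_of_mem_bot {F : Subring T} (hF : IsField F) {n : T}
    (hn : n ∈ (⊥ : Subring T)) : n = 0 ∨ IsUnit n := by
  by_cases h : n = 0
  · exact Or.inl h
  · obtain ⟨b, hb⟩ := hF.mul_inv_cancel (a := ⟨n, (bot_le : ⊥ ≤ F) hn⟩)
      fun h' => h (congrArg Subtype.val h')
    exact Or.inr (IsUnit.of_mul_eq_one (b : T) (congrArg Subtype.val hb))

theorem eq_zero_or_isUnit_of_mem_adjoinSat_bot [Nontrivial T] {F : Subring T} (hF : IsField F)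
    {z : T} (hz : z ∈ adjoinSat (⊥ : Subring T) 0) : z = 0 ∨ IsUnit z := by
  obtain ⟨g, f, hg, hgf⟩ := mem_adjoinSat.1 hz
  have hbot : ∀ f : (⊥ : Subring T)[X], evalAt ⊥ 0 f = f.coeff 0 := fun f => by
    simp [evalAt, eval₂_at_zero]
  rw [hbot] at hg
  rw [hbot, hbot] at hgf
  have hgu := (eq_zero_or_isUnit_of_mem_bot hF (g.coeff 0).2).resolve_left
    (nonZeroDivisors.ne_zero hg)
  rcases eq_zero_or_isUnit_of_mem_bot hF (f.coeff 0).2 with h | h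
  · left
    rw [h] at hgf
    exact (hgu.mul_right_eq_zero).1 hgf
  · right
    rw [← hgf] at h
    exact isUnit_of_mul_isUnit_right h

theorem isTame_of_eq_zero_or_isUnit {P : Ideal T} (hP : P ≠ ⊤) {R : Subring T}
    (hR : ∀ z ∈ R, z = 0 ∨ IsUnit z)
    (hsat : ∀ z ∈ R, z ≠ 0 → ∀ v, z * v ∈ R → v ∈ R) : IsTame P R where
  regular r hr h0 := ((hR r hr).resolve_left h0).mem_nonZeroDivisors
  notMem r hr h0 h := hP (Ideal.eq_top_of_isUnit_mem _ h ((hR r hr).resolve_left h0))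
  mem_of_mul_mem := hsat
  exists_generator J hJ := ⟨0, R.zero_mem, J.zero_mem, fun z hz hzJ =>
    ⟨0, R.zero_mem, by simpa using (hR z hz).resolve_right (hJ.not_isUnit hzJ)⟩⟩

theorem exists_evalAt_eq_pow_mul [IsLocalRing T] {R : Subring T}
    (hR : ∀ z ∈ R, z = 0 ∨ IsUnit z) {y : T} (hy : y ∈ maximalIdeal T) (f : R[X]) (hf : f ≠ 0) :
    ∃ k : ℕ, ∃ v : T, IsUnit v ∧ evalAt R y f = y ^ k * v := by
  classical
  induction f using Polynomial.recOnHorner with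
  | M0 => exact absurd rfl hf
  | MC p a hp ha _ =>
    obtain ⟨p', rfl⟩ := X_dvd_iff.2 hp
    refine ⟨0, evalAt R y (X * p' + C a), ?_, by simp⟩
    have hau : IsUnit (a : T) := (hR a a.2).resolve_left fun h => ha (Subtype.ext h)
    by_contra hu
    have h1 : evalAt R y (X * p' + C a) ∈ maximalIdeal T := hu
    simp only [map_add, map_mul, evalAt_X, evalAt_C] at h1
    exact (mem_maximalIdeal _).1
      ((Ideal.add_mem_iff_right _ (Ideal.mul_mem_right _ _ hy)).1 h1) hau
  | MX p hp ih =>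
    obtain ⟨k, v, hv, e⟩ := ih hp
    exact ⟨k + 1, v, hv, by rw [map_mul, e, evalAt_X]; ring⟩

/-- The countable tame subring generated by `y`. -/
theorem exists_isTame_base [IsLocalRing T] [IsNoetherianRing T] {F : Subring T} (hF : IsField F)
    {P : Ideal T} (hP : P.IsPrime) {y : T} (hyreg : y ∈ nonZeroDivisors T)
    (hym : y ∈ maximalIdeal T) (hyP : y ∉ P) :
    ∃ R : Subring T, IsTame P R ∧ #R ≤ ℵ₀ ∧ y ∈ R := by
  have hR := fun z => eq_zero_or_isUnit_of_mem_adjoinSat_bot hF (z := z)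
  have htame : IsTame P (adjoinSat (⊥ : Subring T) 0) :=
    isTame_of_eq_zero_or_isUnit hP.ne_top hR fun z hz hz0 v hv =>
      mem_saturation_of_mul_mem hz ((hR z hz).resolve_left hz0).mem_nonZeroDivisors hv
  have hev := exists_evalAt_eq_pow_mul hR hym
  refine ⟨adjoinSat (adjoinSat ⊥ 0) y, (htame.isTame_and_extends_adjoinSat (fun f hf => ?_)
    (fun f hf h => ?_) fun J hJ q hq hg => ?_).1, ?_, self_mem_adjoinSat _ _⟩
  · obtain ⟨k, v, hv, e⟩ := hev f hf
    rw [e]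
    exact mul_mem (pow_mem hyreg k) hv.mem_nonZeroDivisors
  · obtain ⟨k, v, hv, e⟩ := hev f hf
    rw [e] at h
    rcases hP.mem_or_mem h with h | h
    · exact hyP (hP.mem_of_pow_mem _ h)
    · exact hP.ne_top (Ideal.eq_top_of_isUnit_mem _ h hv)
  · exact absurd ((hR q hg.mem).resolve_left hq) (hJ.not_isUnit hg.mem_ideal)
  · have hbot : #(⊥ : Subring T) ≤ ℵ₀ := by
      have : Countable ((⊥ : Subring T) : Set T) := by
        rw [Subring.coe_bot]
        exact Set.countable_range _
      exact mk_le_aleph0_iff.2 this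
    exact (mk_adjoinSat_le _ _).trans
      (max_le le_rfl ((mk_adjoinSat_le _ _).trans (max_le le_rfl hbot)))

end Base

variable [IsLocalRing T]

/-- Tame subrings in which linear equations over `T` descend, and which surject onto `T` modulo
the square of the maximal ideal. -/
structure IsDense (P : Ideal T) (A : Subring T) : Prop extends IsTame P A where
  mem_span : ∀ s : Finset T, (∀ e ∈ s, e ∈ A) → ∀ c ∈ A, c ∈ Ideal.span (s : Set T) →
    c ∈ Submodule.span A (s : Set T)
  exists_sub_mem : ∀ t : T, ∃ x ∈ A, x - t ∈ maximalIdeal T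
  map_comap : ((maximalIdeal T).comap A.subtype).map A.subtype = maximalIdeal T

namespace IsDense

variable {P : Ideal T} {A : Subring T}

theorem isLocalHom (hA : IsDense P A) : IsLocalHom A.subtype where
  map_nonunit z hz := by
    obtain ⟨v, hv⟩ := hz.exists_right_inv
    have hvA : v ∈ A := hA.mem_of_mul_mem z z.2 hz.ne_zero v (hv ▸ A.one_mem)
    exact IsUnit.of_mul_eq_one (⟨v, hvA⟩ : A) (Subtype.ext hv)

theorem isDomain (hA : IsDense P A) : IsDomain A :=
  have := hA.toIsTame.noZeroDivisors
  NoZeroDivisors.to_isDomain A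

theorem map_comap_pow (hA : IsDense P A) (n : ℕ) :
    (((maximalIdeal T).comap A.subtype) ^ n).map A.subtype = maximalIdeal T ^ n := by
  rw [Ideal.map_pow, hA.map_comap]

theorem mem_span_of_mem_map_span (hA : IsDense P A) {s : Set A} (hs : s.Finite) {c : A}
    (hc : (c : T) ∈ (Ideal.span s).map A.subtype) : c ∈ Ideal.span s := by
  rw [Ideal.map_span] at hc
  have hfin := hs.image A.subtype
  have h := hA.mem_span hfin.toFinset (fun e he => by
    obtain ⟨x, -, rfl⟩ := hfin.mem_toFinset.1 he
    exact x.2) c c.2 (by simpa using hc)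
  have himage : (A.subtype '' s) = Algebra.linearMap A T '' s := rfl
  rw [hfin.coe_toFinset, himage, Submodule.span_image] at h
  obtain ⟨d, hd, e⟩ := h
  rwa [← (Subtype.ext e : d = c)]

theorem exists_sub_mem_pow_succ (hA : IsDense P A) {n : ℕ} {z : T}
    (hz : z ∈ maximalIdeal T ^ n) :
    ∃ a ∈ A, a ∈ maximalIdeal T ^ n ∧ a - z ∈ maximalIdeal T ^ (n + 1) := by
  rw [← hA.map_comap_pow, Ideal.map] at hz
  induction hz using Submodule.span_induction with
  | mem z hz =>
    obtain ⟨a, ha, rfl⟩ := hz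
    exact ⟨a, a.2, hA.map_comap_pow n ▸ Ideal.mem_map_of_mem A.subtype ha, by simp⟩
  | zero => exact ⟨0, A.zero_mem, zero_mem _, by simp⟩
  | add z z' _ _ h h' =>
    obtain ⟨a, ha, ha', haz⟩ := h
    obtain ⟨b, hb, hb', hbz⟩ := h'
    refine ⟨a + b, A.add_mem ha hb, add_mem ha' hb', ?_⟩
    convert add_mem haz hbz using 1
    ring
  | smul t z _ h =>
    obtain ⟨a, ha, ha', haz⟩ := h
    obtain ⟨b, hb, hbt⟩ := hA.exists_sub_mem t
    refine ⟨b * a, A.mul_mem hb ha, Ideal.mul_mem_left _ _ ha', ?_⟩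
    have e : b * a - t • z = a * (b - t) + t * (a - z) := by rw [smul_eq_mul]; ring
    rw [e]
    refine add_mem ?_ (Ideal.mul_mem_left _ _ haz)
    rw [pow_succ]
    exact Ideal.mul_mem_mul ha' hbt

theorem exists_sub_mem_pow (hA : IsDense P A) (t : T) (n : ℕ) :
    ∃ a : A, (a : T) - t ∈ maximalIdeal T ^ n := by
  induction n with
  | zero => exact ⟨0, by simp⟩
  | succ n ih =>
    obtain ⟨a, ha⟩ := ih
    obtain ⟨b, hb, -, hb'⟩ := hA.exists_sub_mem_pow_succ ha
    refine ⟨a - ⟨b, hb⟩, ?_⟩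
    rw [← neg_mem_iff]
    convert hb' using 1
    push_cast
    ring

end IsDense

variable [IsNoetherianRing T]

theorem isAdmissible_of_regular {P : Ideal T} (hP : P.IsPrime) (hPm : P ≠ maximalIdeal T)
    {x₁ x₂ : T} (h₁ : x₁ ∈ maximalIdeal T) (h₂ : x₂ ∈ maximalIdeal T)
    (hreg₁ : x₁ ∈ nonZeroDivisors T) (hreg₂ : ∀ v, x₁ ∣ x₂ * v → x₁ ∣ v) : IsAdmissible P where
  isPrime := hP
  ne_maximalIdeal := hPm
  not_isGradeOnePrime h := by
    obtain ⟨v, hv⟩ := h.exists_colon_of_mem hreg₁ h₁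
    have := hreg₂ v ((hv x₂).1 h₂)
    exact h.isPrime.one_notMem ((hv 1).2 (by rwa [one_mul]))
  notMem_associatedPrimes h := notMem_of_mem_nonZeroDivisors hreg₁ h h₁

theorem isAdmissible_of_isRegular {P : Ideal T} (hP : P.IsPrime) (hPm : P ≠ maximalIdeal T)
    {rs : List T} (hlen : rs.length = 2) (hmem : ∀ x ∈ rs, x ∈ maximalIdeal T)
    (hreg : RingTheory.Sequence.IsRegular T rs) : IsAdmissible P := by
  obtain ⟨x₁, x₂, rfl⟩ := List.length_eq_two.1 hlen
  rw [RingTheory.Sequence.isRegular_cons_iff, RingTheory.Sequence.isRegular_cons_iff] at hreg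
  obtain ⟨h1, h2, -⟩ := hreg
  refine isAdmissible_of_regular hP hPm (hmem x₁ (by simp)) (hmem x₂ (by simp)) ?_ fun v hv => ?_
  · rw [mem_nonZeroDivisors_iff_right]
    intro z hz
    exact h1 (by simpa [mul_comm] using hz)
  · have hiff : ∀ z : T, (Submodule.Quotient.mk z : QuotSMulTop x₁ T) = 0 ↔ x₁ ∣ z := fun z => by
      rw [Submodule.Quotient.mk_eq_zero, Submodule.mem_smul_pointwise_iff_exists]
      simp [dvd_def, eq_comm]
    rw [← hiff] at hv ⊢
    exact h2 (hv.trans (smul_zero x₂).symm)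

theorem exists_isDense [IsAdicComplete (maximalIdeal T) T] {P : Ideal T} (hP : IsAdmissible P)
    {R₀ : Subring T} (hR₀ : IsTame P R₀) (hR₀c : #R₀ ≤ ℵ₀) :
    ∃ A : Subring T, R₀ ≤ A ∧ IsDense P A := by
  obtain ⟨g, hg⟩ := IsNoetherian.noetherian (maximalIdeal T)
  let l : ResidueField T → T := Function.surjInv residue_surjective
  have hl : ∀ c, residue T (l c) = c := Function.surjInv_eq residue_surjective
  obtain ⟨A, hA, hAt, happ, hcl⟩ := exists_isTame_closed hP hR₀ hR₀c
    (𝒰 := Set.range l ∪ g)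
    ((mk_union_le _ _).trans ((add_le_add (mk_range_le.trans (le_max_right ℵ₀ _))
      ((lt_aleph0_iff_set_finite.2 g.finite_toSet).le.trans (le_max_left _ _))).trans_eq
      (add_eq_self (le_max_left _ _)))) ⟨l 0, Or.inl ⟨0, rfl⟩⟩
  have hm2 : maximalIdeal T ^ 2 ≤ maximalIdeal T := Ideal.pow_le_self two_ne_zero
  refine ⟨A, hA, hAt, hcl, fun t => ?_, le_antisymm Ideal.map_comap_le ?_⟩
  · obtain ⟨x, hx, hxl⟩ := happ (l (residue T t)) (Or.inl ⟨_, rfl⟩)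
    have h1 : l (residue T t) - t ∈ maximalIdeal T := Ideal.Quotient.eq.1 (hl (residue T t))
    exact ⟨x, hx, by simpa using add_mem (hm2 hxl) h1⟩
  · refine Submodule.le_of_le_smul_of_le_jacobson_bot (I := maximalIdeal T) ⟨g, hg⟩
      (jacobson_eq_maximalIdeal ⊥ bot_ne_top).ge ?_
    have hgm : ∀ z ∈ g, z ∈ maximalIdeal T := fun z hz => hg ▸ Submodule.subset_span hz
    conv_lhs => rw [← hg]
    refine Submodule.span_le.2 fun z hz => ?_
    obtain ⟨x, hx, hxz⟩ := happ z (Or.inr hz)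
    have hxm : x ∈ maximalIdeal T := by simpa using add_mem (hm2 hxz) (hgm z hz)
    have : z = x + -(x - z) := by ring
    rw [this]
    refine Submodule.add_mem_sup (Ideal.mem_map_of_mem A.subtype
      (x := (⟨x, hx⟩ : A)) hxm) (neg_mem ?_)
    rwa [smul_eq_mul, ← pow_two]

namespace IsDense

variable {P : Ideal T} {A : Subring T}

theorem isNoetherianRing (hA : IsDense P A) : IsNoetherianRing A := by
  refine isNoetherianRing_iff_ideal_fg A |>.2 fun I => ?_
  obtain ⟨s, hs, he⟩ := (Submodule.fg_span_iff_fg_span_finset_subset (A.subtype '' (I : Set A))).1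
    (IsNoetherian.noetherian (Ideal.span (A.subtype '' (I : Set A))))
  have hfin : (A.subtype ⁻¹' s).Finite := s.finite_toSet.preimage Subtype.val_injective.injOn
  have himage : A.subtype '' (A.subtype ⁻¹' s) = s :=
    Set.image_preimage_eq_of_subset (hs.trans (Set.image_subset_range _ _))
  refine Submodule.fg_def.2 ⟨A.subtype ⁻¹' s, hfin, le_antisymm (Ideal.span_le.2 ?_) ?_⟩
  · intro z hz
    obtain ⟨z', hz', e⟩ := hs hz
    rwa [← (Subtype.ext e : z' = z)]
  · intro c hc
    refine hA.mem_span_of_mem_map_span hfin ?_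
    rw [Ideal.map_span, himage]
    change (c : T) ∈ Submodule.span T (s : Set T)
    rw [← he]
    exact Submodule.subset_span ⟨c, hc, rfl⟩

theorem comap_map_eq (hA : IsDense P A) (I : Ideal A) :
    (I.map A.subtype).comap A.subtype = I := by
  refine le_antisymm (fun c hc => ?_) Ideal.le_comap_map
  have := hA.isNoetherianRing
  obtain ⟨s, rfl⟩ := IsNoetherian.noetherian I
  exact hA.mem_span_of_mem_map_span s.finite_toSet hc

theorem comap_pow (hA : IsDense P A) (n : ℕ) :
    (maximalIdeal T ^ n).comap A.subtype = ((maximalIdeal T).comap A.subtype) ^ n := by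
  rw [← hA.map_comap_pow, hA.comap_map_eq]

theorem uniqueFactorizationMonoid (hA : IsDense P A) [IsDomain A] :
    UniqueFactorizationMonoid A := by
  have := hA.isNoetherianRing
  have hloc := hA.isLocalHom
  refine { (inferInstance : WfDvdMonoid A) with irreducible_iff_prime := fun {z} => ?_ }
  refine ⟨fun hz => ⟨hz.ne_zero, hz.not_isUnit, fun a b hab => ?_⟩, Prime.irreducible⟩
  have hz0 : (z : T) ≠ 0 := fun h => hz.ne_zero (Subtype.ext h)
  obtain ⟨J, hJ, hzJ⟩ := exists_isGradeOnePrime_mem (hA.regular z z.2 hz0)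
    fun h => hz.not_isUnit (hloc.map_nonunit z h)
  obtain ⟨q, hq⟩ := hA.exists_generator J hJ
  obtain ⟨w, hw, e⟩ := hq.exists_eq_mul z z.2 hzJ
  have hwu : IsUnit (⟨w, hw⟩ : A) := (hz.isUnit_or_isUnit
    (Subtype.ext e : z = (⟨q, hq.mem⟩ : A) * ⟨w, hw⟩)).resolve_left
      fun h => hJ.not_isUnit hq.mem_ideal (h.map A.subtype)
  have hdvd : ∀ a : A, (a : T) ∈ J → z ∣ a := fun a ha => by
    obtain ⟨v, hv, e'⟩ := hq.exists_eq_mul a a.2 ha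
    rw [(Subtype.ext e : z = (⟨q, hq.mem⟩ : A) * ⟨w, hw⟩), hwu.mul_right_dvd]
    exact ⟨⟨v, hv⟩, Subtype.ext e'⟩
  obtain ⟨v, hv⟩ := hab
  have habJ : (a : T) * b ∈ J := by
    have := congrArg Subtype.val hv
    simp only [Subring.coe_mul] at this
    exact this ▸ J.mul_mem_right _ hzJ
  exact (hJ.isPrime.mem_or_mem habJ).imp (hdvd a) (hdvd b)

theorem nonempty_ringEquiv [IsAdicComplete (maximalIdeal T) T] (hA : IsDense P A) :
    Nonempty (AdicCompletion ((maximalIdeal T).comap A.subtype) A ≃+* T) := by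
  set I := (maximalIdeal T).comap A.subtype with hI
  let ψ : (n : ℕ) → A ⧸ I ^ n →+* T ⧸ maximalIdeal T ^ n := fun n =>
    Ideal.quotientMap _ A.subtype (hA.comap_pow n).ge
  have hψ : ∀ n, Function.Injective (ψ n) := fun n =>
    Ideal.quotientMap_injective' (hA.comap_pow n).le
  let f : (n : ℕ) → AdicCompletion I A →+* T ⧸ maximalIdeal T ^ n := fun n =>
    (ψ n).comp (AdicCompletion.evalₐ I n : AdicCompletion I A →+* A ⧸ I ^ n)
  have hf : ∀ {m n : ℕ} (hle : m ≤ n),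
      (Ideal.Quotient.factorPow (maximalIdeal T) hle).comp (f n) = f m := by
    intro m n hle
    ext x
    obtain ⟨x, rfl⟩ := AdicCompletion.mk_surjective I A x
    simp only [f, ψ, RingHom.comp_apply, RingHom.coe_coe, AdicCompletion.evalₐ_mk,
      Ideal.quotientMap_mk]
    exact congrArg (ψ m) (AdicCompletion.Ideal.mk_eq_mk I hle x)
  let F := IsAdicComplete.liftRingHom (maximalIdeal T) f hf
  have hF : ∀ n x, Ideal.Quotient.mk (maximalIdeal T ^ n) (F x) = f n x := fun n x =>
    IsAdicComplete.mk_liftRingHom _ _ _ _ _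
  refine ⟨RingEquiv.ofBijective F ⟨fun x x' h => ?_, fun t => ?_⟩⟩
  · exact AdicCompletion.ext_evalₐ fun n => hψ n (by
      have := (hF n x).symm.trans ((congrArg _ h).trans (hF n x'))
      exact this)
  · choose a ha using hA.exists_sub_mem_pow t
    have hcauchy : ∀ n, a n ≡ a (n + 1) [SMOD (I ^ n • ⊤ : Submodule A A)] := fun n => by
      rw [SModEq.sub_mem, smul_eq_mul, Ideal.mul_top, ← hA.comap_pow, Ideal.mem_comap]
      convert sub_mem (ha n) (Ideal.pow_le_pow_right (Nat.le_succ n) (ha (n + 1))) using 1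
      simp
    refine ⟨AdicCompletion.mk I A (AdicCompletion.AdicCauchySequence.mk I A a hcauchy), ?_⟩
    rw [← sub_eq_zero]
    refine IsHausdorff.haus (I := maximalIdeal T) inferInstance _ fun n => ?_
    rw [SModEq.zero, smul_eq_mul, Ideal.mul_top, ← Ideal.Quotient.eq_zero_iff_mem, map_sub,
      sub_eq_zero, hF]
    simp only [f, ψ, RingHom.comp_apply, RingHom.coe_coe, AdicCompletion.evalₐ_mk,
      Ideal.quotientMap_mk]
    exact Ideal.Quotient.eq.2 (ha n)

end IsDense

end Precompletion

/-- UFD precompletions of complete local equicharacteristic rings of depth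
at least two. -/
theorem UFD_precompletion_equicharacteristic
    (T : Type*) [CommRing T] [IsLocalRing T] [IsNoetherianRing T]
    [IsAdicComplete (maximalIdeal T) T]
    (hequi : ∃ F : Subring T, IsField F)
    (hdepth : DepthGE T 2)
    (P : Ideal T) (hP : P.IsPrime) (hPm : P ≠ maximalIdeal T)
    (y : T) (hyreg : y ∈ nonZeroDivisors T) (hym : y ∈ maximalIdeal T) (hyP : y ∉ P) :
    ∃ (A : Subring T) (_ : IsDomain A),
      UniqueFactorizationMonoid A ∧ IsNoetherianRing A ∧ IsLocalRing A ∧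
      (Ideal.comap A.subtype (maximalIdeal T)).IsMaximal ∧
      Nonempty (AdicCompletion (Ideal.comap A.subtype (maximalIdeal T)) A ≃+* T) ∧
      (∀ x : T, x ∈ A → x ∈ P → x = 0) ∧
      ∃ t : Tˣ, y * (t : T) ∈ A := by
  obtain ⟨F, hF⟩ := hequi
  obtain ⟨rs, hlen, hmem, hreg⟩ := hdepth
  have hadm := Precompletion.isAdmissible_of_isRegular hP hPm hlen hmem hreg
  obtain ⟨R₀, hR₀, hR₀c, hy⟩ := Precompletion.exists_isTame_base hF hP hyreg hym hyP
  obtain ⟨A, hle, hA⟩ := Precompletion.exists_isDense hadm hR₀ hR₀c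
  have := hA.isDomain
  have := hA.isLocalHom
  have hloc : IsLocalRing A := RingHom.domain_isLocalRing A.subtype
  refine ⟨A, hA.isDomain, hA.uniqueFactorizationMonoid, hA.isNoetherianRing, hloc, ?_,
    hA.nonempty_ringEquiv, fun x hx hxP => by_contra fun h0 => hA.notMem x hx h0 hxP, 1,
    by simpa using hle hy⟩
  rw [IsLocalRing.maximalIdeal_comap A.subtype]
  infer_instance
end
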